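/- arXiv:2502.07114 — 4 statements merged into one kernel-verified Lean document; each statement's English description precedes it below -/
import Mathlib

section
/- Let x_1, …, x_{t+1} ∈ R^d be arbitrary vectors and φ_0, …, φ_t > 0 arbitrary positive weights, with t ≥ 1. For each s ≤ t+1 define x̄_s = (1/s)Σ_{i=1}^s x_i, v_s = (1/s)Σ_{i=1}^s (1/φ_{i−1})x_i, a_s = (1/s)Σ_{i=1}^s 1/φ_{i−1}, and Ξ̂_s = (1/s)Σ_{i=1}^s (1/φ_{i−1})(x_i − x̄_s)(x_i − x̄_s)^T. Then Ξ̂_{t+1} = (t/(t+1))(Ξ̂_t + R_t Λ_t R_t^T), where R_t = [v_t − a_t x̄_t, x̄_t − x̄_{t+1}, x_{t+1} − x̄_{t+1}] ∈ R^{d×3} and Λ_t ∈ R^{3×3} is the matrix with rows (0, 1, 0), (1, a_t, 0), (0, 0, 1/(tφ_t)). -/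
open Matrix

noncomputable section

/-- the unweighted mean `x̄_s = (1/s) ∑_{i=1}^s x_i`. -/
def xbarW {d : ℕ} (x : ℕ → Fin d → ℝ) (s : ℕ) : Fin d → ℝ :=
  (s : ℝ)⁻¹ • ∑ i ∈ Finset.range s, x (i + 1)

/-- `v_s = (1/s) ∑_{i=1}^s (1/φ_{i-1}) x_i`. -/
def vbarW {d : ℕ} (x : ℕ → Fin d → ℝ) (φ : ℕ → ℝ) (s : ℕ) : Fin d → ℝ :=
  (s : ℝ)⁻¹ • ∑ i ∈ Finset.range s, (φ i)⁻¹ • x (i + 1)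

/-- `a_s = (1/s) ∑_{i=1}^s 1/φ_{i-1}`. -/
def abarW (φ : ℕ → ℝ) (s : ℕ) : ℝ :=
  (s : ℝ)⁻¹ * ∑ i ∈ Finset.range s, (φ i)⁻¹

/-- the weighted sample covariance
`Ξ̂_s = (1/s) ∑_{i=1}^s (1/φ_{i-1}) (x_i − x̄_s)(x_i − x̄_s)ᵀ`. -/
def XihatW {d : ℕ} (x : ℕ → Fin d → ℝ) (φ : ℕ → ℝ) (s : ℕ) : Matrix (Fin d) (Fin d) ℝ :=
  (s : ℝ)⁻¹ • ∑ i ∈ Finset.range s,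
    (φ i)⁻¹ • Matrix.vecMulVec (x (i + 1) - xbarW x s) (x (i + 1) - xbarW x s)

/-- `R_t = [v_t − a_t x̄_t, x̄_t − x̄_{t+1}, x_{t+1} − x̄_{t+1}] ∈ ℝ^{d×3}`. -/
def RmatW {d : ℕ} (x : ℕ → Fin d → ℝ) (φ : ℕ → ℝ) (t : ℕ) : Matrix (Fin d) (Fin 3) ℝ :=
  Matrix.of fun i k =>
    ![(vbarW x φ t - abarW φ t • xbarW x t) i,
      (xbarW x t - xbarW x (t + 1)) i,
      (x (t + 1) - xbarW x (t + 1)) i] k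

/-- `Λ_t ∈ ℝ^{3×3}`, the matrix with rows `(0,1,0)`, `(1,a_t,0)`, `(0,0,1/(tφ_t))`. -/
def ΛmatW (φ : ℕ → ℝ) (a : ℝ) (t : ℕ) : Matrix (Fin 3) (Fin 3) ℝ :=
  !![0, 1, 0; 1, a, 0; 0, 0, ((t : ℝ) * φ t)⁻¹]

/-- Entrywise expansion of a weighted sum of centred products. -/
theorem sum_weighted_sub_mul_sub {ι : Type*} (s : Finset ι) (w f g : ι → ℝ) (b c : ℝ) :
    ∑ i ∈ s, w i * ((f i - b) * (g i - c)) =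
      ∑ i ∈ s, w i * (f i * g i) - c * ∑ i ∈ s, w i * f i - b * ∑ i ∈ s, w i * g i +
        b * c * ∑ i ∈ s, w i := by
  simp only [Finset.mul_sum, ← Finset.sum_sub_distrib, ← Finset.sum_add_distrib]
  exact Finset.sum_congr rfl fun i _ => by ring

/-- **Rank-3 online update of the weighted sample covariance.**
For arbitrary vectors `x_1, …, x_{t+1} ∈ ℝ^d` and positive weights `φ_0, …, φ_t` (`t ≥ 1`),
`Ξ̂_{t+1} = (t/(t+1)) (Ξ̂_t + R_t Λ_t R_tᵀ)`. -/
theorem weighted_sample_cov_rank3_update {d : ℕ} (t : ℕ) (ht : 1 ≤ t)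
    (x : ℕ → Fin d → ℝ) (φ : ℕ → ℝ) (hφ : ∀ i ≤ t, 0 < φ i) :
    XihatW x φ (t + 1) =
      ((t : ℝ) / ((t : ℝ) + 1)) •
        (XihatW x φ t + RmatW x φ t * ΛmatW φ (abarW φ t) t * (RmatW x φ t)ᵀ) := by
  have ht0 : (t : ℝ) ≠ 0 := by positivity
  have hφt : φ t ≠ 0 := (hφ t le_rfl).ne'
  ext i j
  simp only [XihatW, RmatW, ΛmatW, vbarW, abarW, Finset.sum_range_succ, Matrix.smul_apply,
    Matrix.add_apply, Matrix.sum_apply, Matrix.vecMulVec_apply, Matrix.mul_apply,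
    Matrix.transpose_apply, Matrix.of_apply, Fin.sum_univ_three, Pi.sub_apply, Pi.smul_apply,
    Finset.sum_apply, smul_eq_mul, Nat.cast_add, Nat.cast_one, sum_weighted_sub_mul_sub]
  generalize xbarW x t = m, xbarW x (t + 1) = m'
  simp
  field_simp
  ring

end
end

section
/- Let (φ_i)_{i≥0} and (ϕ_i)_{i≥0} be positive real sequences and let σ_1, …, σ_l > 0 (l ≥ 1 fixed). Suppose lim_{i→∞} i(1 − φ_{i−1}/φ_i) = φ for a constant φ ∈ R, lim_{i→∞} ϕ_i = 0, and lim_{i→∞} iϕ_i = ṽ for some ṽ ∈ (0, ∞] (interpreting φ/ṽ = 0 when ṽ = ∞). If Σ_{k=1}^l σ_k + φ/ṽ > 0, then: (a) (1/φ_t) Σ_{i=0}^t [∏_{j=i+1}^t ∏_{k=1}^l (1 − ϕ_j σ_k)] ϕ_i φ_i → 1/(Σ_{k=1}^l σ_k + φ/ṽ) as t → ∞; and (b) for any constant b ∈ R and any sequence (a_i) with a_i → 0, (1/φ_t){Σ_{i=0}^t [∏_{j=i+1}^t ∏_{k=1}^l (1 − ϕ_j σ_k)] ϕ_i φ_i a_i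 + b·∏_{j=0}^t ∏_{k=1}^l (1 − ϕ_j σ_k)} → 0 as t → ∞. -/
open Filter
open scoped ENNReal

/-- A relaxation recursion `z (t + 1) = (1 - w t) z t + w t e t` whose weights dominate a multiple of
the harmonic sequence follows the limit of its forcing term. -/
theorem tendsto_of_relaxation {z w e : ℕ → ℝ} {c L : ℝ} (hc : 0 < c)
    (hz : ∀ᶠ t in atTop, z (t + 1) = (1 - w t) * z t + w t * e t)
    (hw : ∀ᶠ t : ℕ in atTop, c * (1 / ((t : ℝ) + 1)) ≤ w t)
    (hw1 : ∀ᶠ t in atTop, w t ≤ 1) (he : Tendsto e atTop (nhds L)) :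
    Tendsto z atTop (nhds L) := by
  rw [Metric.tendsto_atTop']
  intro ε hε
  have he' := (Metric.tendsto_nhds.1 he) (ε / 2) (by positivity)
  obtain ⟨N, hN⟩ := eventually_atTop.1 (hz.and (hw.and (hw1.and he')))
  set H : ℕ → ℝ := fun t => ∑ i ∈ Finset.range t, 1 / ((i : ℝ) + 1) with hH
  set M : ℝ := |z N - L| * Real.exp (c * H N) with hM
  have bound : ∀ t, N ≤ t → |z t - L| ≤ ε / 2 + M * Real.exp (-(c * H t)) := by
    intro t ht
    induction t, ht using Nat.le_induction with
    | base =>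
      rw [hM, mul_assoc, ← Real.exp_add, add_neg_cancel, Real.exp_zero]
      linarith
    | succ t ht ih =>
      obtain ⟨h1, h2, h3, h4⟩ := hN t ht
      rw [Real.dist_eq] at h4
      have hw0 : 0 ≤ w t := le_trans (by positivity) h2
      have hstep : z (t + 1) - L = (1 - w t) * (z t - L) + w t * (e t - L) := by
        rw [h1]; ring
      have hHs : Real.exp (-(c * H (t + 1))) =
          Real.exp (-(c * (1 / ((t : ℝ) + 1)))) * Real.exp (-(c * H t)) := by
        rw [← Real.exp_add]; simp only [hH, Finset.sum_range_succ]; ring_nf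
      have hexp : 1 - w t ≤ Real.exp (-(c * (1 / ((t : ℝ) + 1)))) := by
        have := Real.add_one_le_exp (-(c * (1 / ((t : ℝ) + 1))))
        linarith
      have hME : 0 ≤ M * Real.exp (-(c * H t)) := by positivity
      calc |z (t + 1) - L| ≤ |(1 - w t) * (z t - L)| + |w t * (e t - L)| := by
            rw [hstep]; exact abs_add_le _ _
        _ = (1 - w t) * |z t - L| + w t * |e t - L| := by
            rw [abs_mul, abs_mul, abs_of_nonneg hw0, abs_of_nonneg (sub_nonneg.2 h3)]
        _ ≤ (1 - w t) * (ε / 2 + M * Real.exp (-(c * H t))) + w t * (ε / 2) := by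
            have := sub_nonneg.2 h3
            gcongr
        _ = ε / 2 + (1 - w t) * (M * Real.exp (-(c * H t))) := by ring
        _ ≤ ε / 2 + Real.exp (-(c * (1 / ((t : ℝ) + 1)))) * (M * Real.exp (-(c * H t))) := by
            gcongr
        _ = ε / 2 + M * Real.exp (-(c * H (t + 1))) := by rw [hHs]; ring
  have hlim : Tendsto (fun t => M * Real.exp (-(c * H t))) atTop (nhds 0) := by
    have hH' : Tendsto H atTop atTop := Real.tendsto_sum_range_one_div_nat_succ_atTop
    simpa using (Real.tendsto_exp_neg_atTop_nhds_zero.comp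
      (hH'.const_mul_atTop hc)).const_mul M
  obtain ⟨N', hN'⟩ := eventually_atTop.1 (hlim.eventually_lt_const (half_pos hε))
  refine ⟨max N N', fun t ht => ?_⟩
  have h1 := bound t ((le_max_left _ _).trans ht.le)
  have h2 := hN' t ((le_max_right _ _).trans ht.le)
  rw [Real.dist_eq]
  linarith

theorem tendsto_prod_one_sub_mul {ι : Type*} (s : Finset ι) (σ : ι → ℝ) {x : ℕ → ℝ}
    (hx : Tendsto x atTop (nhds 0)) :
    Tendsto (fun t => ∏ k ∈ s, (1 - x t * σ k)) atTop (nhds 1) := by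
  simpa using tendsto_finsetProd s fun k _ => (hx.mul_const (σ k)).const_sub 1

theorem tendsto_one_sub_prod_div {ι : Type*} (s : Finset ι) (σ : ι → ℝ) {x : ℕ → ℝ}
    (hx : Tendsto x atTop (nhds 0)) (hx0 : ∀ t, x t ≠ 0) :
    Tendsto (fun t => (1 - ∏ k ∈ s, (1 - x t * σ k)) / x t) atTop (nhds (∑ k ∈ s, σ k)) := by
  classical
  induction s using Finset.induction_on with
  | empty => simp
  | insert k s hk ih =>
    have h := ((tendsto_prod_one_sub_mul s σ hx).const_mul (σ k)).add ih
    rw [mul_one] at h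
    rw [Finset.sum_insert hk]
    refine h.congr fun t => ?_
    rw [Finset.prod_insert hk]
    field_simp [hx0 t]
    ring

theorem sum_prod_Icc_succ (p x : ℕ → ℝ) (b : ℝ) (t : ℕ) :
    (∑ i ∈ Finset.range (t + 1 + 1), (∏ j ∈ Finset.Icc (i + 1) (t + 1), p j) * x i) +
        b * ∏ j ∈ Finset.Icc 0 (t + 1), p j =
      p (t + 1) * ((∑ i ∈ Finset.range (t + 1), (∏ j ∈ Finset.Icc (i + 1) t, p j) * x i) +
        b * ∏ j ∈ Finset.Icc 0 t, p j) + x (t + 1) := by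
  rw [Finset.sum_range_succ, Finset.prod_Icc_succ_top (Nat.zero_le _),
    Finset.Icc_eq_empty_of_lt (Nat.lt_succ_self _), Finset.prod_empty, one_mul, mul_add,
    Finset.mul_sum]
  have h : ∀ i ∈ Finset.range (t + 1),
      (∏ j ∈ Finset.Icc (i + 1) (t + 1), p j) * x i =
        p (t + 1) * ((∏ j ∈ Finset.Icc (i + 1) t, p j) * x i) := by
    intro i hi
    rw [Finset.prod_Icc_succ_top (by have := Finset.mem_range.1 hi; omega)]
    ring
  rw [Finset.sum_congr rfl h]
  ring

theorem tendsto_inv_of_tendsto_ofReal {x : ℕ → ℝ} (hx : ∀ t, 0 ≤ x t) {v : ℝ≥0∞} (hv : 0 < v)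
    (h : Tendsto (fun t => ENNReal.ofReal (x t)) atTop (nhds v)) :
    Tendsto (fun t => (x t)⁻¹) atTop (nhds v⁻¹.toReal) := by
  have hi := (ENNReal.tendsto_toReal (ENNReal.inv_ne_top.2 hv.ne')).comp (tendsto_inv_iff.2 h)
  refine hi.congr fun t => ?_
  simp [ENNReal.toReal_inv, ENNReal.toReal_ofReal (hx t)]

/-- The rescaled weighted sums, with a convergent factor `a` and an initial term `b`. -/
theorem tendsto_weighted_sum (φse ϕse : ℕ → ℝ) {ι : Type*} [Fintype ι] (σ : ι → ℝ)
    (φ : ℝ) (vtil : ℝ≥0∞)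
    (hφpos : ∀ i, 0 < φse i) (hϕpos : ∀ i, 0 < ϕse i)
    (hφ : Tendsto (fun i : ℕ => (i : ℝ) * (1 - φse (i - 1) / φse i)) atTop (nhds φ))
    (hϕ0 : Tendsto ϕse atTop (nhds 0))
    (hvtil : 0 < vtil)
    (hiϕ : Tendsto (fun i : ℕ => ENNReal.ofReal ((i : ℝ) * ϕse i)) atTop (nhds vtil))
    (hcond : 0 < (∑ k, σ k) + φ * vtil⁻¹.toReal)
    (b : ℝ) (a : ℕ → ℝ) (α : ℝ) (ha : Tendsto a atTop (nhds α)) :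
    Tendsto (fun t : ℕ => (φse t)⁻¹ *
        ((∑ i ∈ Finset.range (t + 1),
          (∏ j ∈ Finset.Icc (i + 1) t, ∏ k, (1 - ϕse j * σ k)) * (ϕse i * φse i * a i)) +
          b * ∏ j ∈ Finset.Icc 0 t, ∏ k, (1 - ϕse j * σ k)))
      atTop (nhds (α / ((∑ k, σ k) + φ * vtil⁻¹.toReal))) := by
  set S : ℝ := (∑ k, σ k) + φ * vtil⁻¹.toReal with hS
  set v : ℝ := vtil⁻¹.toReal with hv
  have hv0 : 0 ≤ v := ENNReal.toReal_nonneg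
  set p : ℕ → ℝ := fun j => ∏ k, (1 - ϕse j * σ k) with hp
  -- `s` is the contraction rate of the recursion relative to the step size
  set s : ℕ → ℝ := fun t => (1 - φse (t - 1) / φse t * p t) / ϕse t with hs
  have hinv : Tendsto (fun i : ℕ => ((i : ℝ) * ϕse i)⁻¹) atTop (nhds v) :=
    tendsto_inv_of_tendsto_ofReal (fun i => mul_nonneg i.cast_nonneg (hϕpos i).le) hvtil hiϕ
  have hsS : Tendsto s atTop (nhds S) := by
    have h := (tendsto_one_sub_prod_div Finset.univ σ hϕ0 fun t => (hϕpos t).ne').add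
      ((tendsto_prod_one_sub_mul Finset.univ σ hϕ0).mul (hφ.mul hinv))
    rw [one_mul] at h
    refine h.congr' ?_
    filter_upwards [eventually_ge_atTop 1] with t ht
    have h1 : (t : ℝ) ≠ 0 := by positivity
    have h2 := (hϕpos t).ne'
    have h3 := (hφpos t).ne'
    simp only [hs, hp]
    field_simp
    ring
  have hshift := tendsto_add_atTop_nat 1
  refine tendsto_of_relaxation (c := S / 2 * (v + 1)⁻¹) (w := fun t => ϕse (t + 1) * s (t + 1))
    (e := fun t => a (t + 1) / s (t + 1)) (by positivity) ?_ ?_ ?_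
    ((ha.div hsS hcond.ne').comp hshift)
  · filter_upwards [hshift.eventually (hsS.eventually_const_lt hcond)] with t ht
    have h1 := (hϕpos (t + 1)).ne'
    have h2 := (hφpos (t + 1)).ne'
    have h3 := (hφpos t).ne'
    have h4 : ϕse (t + 1) * s (t + 1) = 1 - φse t / φse (t + 1) * p (t + 1) := by
      simp only [hs, Nat.add_sub_cancel]
      field_simp
    have h5 : ϕse (t + 1) * s (t + 1) * (a (t + 1) / s (t + 1)) = ϕse (t + 1) * a (t + 1) := by
      have := ht.ne'
      field_simp
    rw [h5, h4, sum_prod_Icc_succ p (fun i => ϕse i * φse i * a i)]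
    field_simp
    ring
  · filter_upwards [hshift.eventually (hsS.eventually_const_lt (half_lt_self hcond)),
      hshift.eventually (hinv.eventually_lt_const (lt_add_one v))] with t h1 h2
    have hϕ := hϕpos (t + 1)
    push_cast at h2
    have ht : (0 : ℝ) < (t : ℝ) + 1 := by positivity
    have h3 : (v + 1)⁻¹ ≤ ((t : ℝ) + 1) * ϕse (t + 1) :=
      inv_le_of_inv_le₀ (by positivity) h2.le
    have h4 : (v + 1)⁻¹ * (1 / ((t : ℝ) + 1)) ≤ ϕse (t + 1) := by
      rw [mul_one_div, div_le_iff₀ ht]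
      linarith
    calc S / 2 * (v + 1)⁻¹ * (1 / ((t : ℝ) + 1))
        = (v + 1)⁻¹ * (1 / ((t : ℝ) + 1)) * (S / 2) := by ring
      _ ≤ ϕse (t + 1) * s (t + 1) := by gcongr
  · have h := (hϕ0.mul hsS).comp hshift
    rw [zero_mul] at h
    filter_upwards [h.eventually_lt_const one_pos] with t ht using ht.le

/-- **Key series lemma** (Lemma B.3(a) of Na–Mangoubi 2022).
Let `(φ_i)`, `(ϕ_i)` be positive sequences and `σ_1, …, σ_l > 0` with
`i (1 − φ_{i-1}/φ_i) → φ`, `ϕ_i → 0` and `i ϕ_i → vtil ∈ (0, ∞]` (with `φ/vtil := 0` if `vtil = ∞`).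
If `∑_k σ_k + φ/vtil > 0` then
(a) `(1/φ_t) ∑_{i=0}^t ∏_{j=i+1}^t ∏_k (1 − ϕ_j σ_k) ϕ_i φ_i → 1/(∑_k σ_k + φ/vtil)`, and
(b) for any `b : ℝ` and any null sequence `(a_i)`,
`(1/φ_t) (∑_{i=0}^t ∏_{j=i+1}^t ∏_k (1 − ϕ_j σ_k) ϕ_i φ_i a_i + b ∏_{j=0}^t ∏_k (1 − ϕ_j σ_k)) → 0`. -/
theorem series_limit_lemma (φse ϕse : ℕ → ℝ) (l : ℕ) (hl : 1 ≤ l) (σ : Fin l → ℝ)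
    (φ : ℝ) (vtil : ℝ≥0∞)
    (hφpos : ∀ i, 0 < φse i) (hϕpos : ∀ i, 0 < ϕse i) (hσ : ∀ k, 0 < σ k)
    (hφ : Tendsto (fun i : ℕ => (i : ℝ) * (1 - φse (i - 1) / φse i)) atTop (nhds φ))
    (hϕ0 : Tendsto ϕse atTop (nhds 0))
    (hvtil : 0 < vtil)
    (hiϕ : Tendsto (fun i : ℕ => ENNReal.ofReal ((i : ℝ) * ϕse i)) atTop (nhds vtil))
    (hcond : 0 < (∑ k, σ k) + φ * vtil⁻¹.toReal) :
    Tendsto (fun t : ℕ => (φse t)⁻¹ *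
        ∑ i ∈ Finset.range (t + 1),
          (∏ j ∈ Finset.Icc (i + 1) t, ∏ k, (1 - ϕse j * σ k)) * (ϕse i * φse i))
      atTop (nhds ((∑ k, σ k) + φ * vtil⁻¹.toReal)⁻¹) ∧
    ∀ (b : ℝ) (a : ℕ → ℝ), Tendsto a atTop (nhds 0) →
      Tendsto (fun t : ℕ => (φse t)⁻¹ *
          ((∑ i ∈ Finset.range (t + 1),
            (∏ j ∈ Finset.Icc (i + 1) t, ∏ k, (1 - ϕse j * σ k)) * (ϕse i * φse i * a i)) +
            b * ∏ j ∈ Finset.Icc 0 t, ∏ k, (1 - ϕse j * σ k)))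
        atTop (nhds 0) := by
  have key := tendsto_weighted_sum φse ϕse σ φ vtil hφpos hϕpos hφ hϕ0 hvtil hiϕ hcond
  refine ⟨?_, fun b a ha => by simpa using key b a 0 ha⟩
  simpa using key 0 (fun _ => 1) 1 tendsto_const_nhds
end

section
/- Let (φ_i)_{i≥0} be a positive sequence with lim_{i→∞} i(1 − φ_{i−1}/φ_i) = φ for a constant φ < 0, let ϕ_i = c_ϕ/(i+1)^v + o(1/(i+1)^v) for constants c_ϕ > 0 and v ∈ (0,1), and let σ_1, …, σ_l > 0 (l ≥ 1 fixed). Write D_t = |(1/φ_t) Σ_{i=0}^t [∏_{j=i+1}^t ∏_{k=1}^l (1 − ϕ_j σ_k)] ϕ_i φ_i − 1/(Σ_{k=1}^l σ_k)|. Then there exists a constant c > 0 independent of t such that for all sufficiently large t: D_t ≤ c·ϕ_t if v ∈ (0, 0.5); D_t ≤ c·(0.5 − (φ/c_ϕ²)/(Σ_{k=1}^l σ_k)²)·ϕ_t if v = 0.5; and D_t ≤ c·(−φ/(Σ_{k=1}^l σ_k)²)·(1/(tϕ_t)) if v ∈ (0.5, 1). -/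
open Filter

/-- First-order expansion of `∏ (1 - x σ_k)` on `[0, 1]` with a uniform quadratic remainder. -/
theorem exists_abs_prod_one_sub_mul_sub_le {ι : Type*} (s : Finset ι) (σ : ι → ℝ) :
    ∃ K : ℝ, 0 ≤ K ∧ ∀ x : ℝ, 0 ≤ x → x ≤ 1 →
      |∏ k ∈ s, (1 - x * σ k) - (1 - x * ∑ k ∈ s, σ k)| ≤ K * x ^ 2 := by
  classical
  induction s using Finset.induction_on with
  | empty => exact ⟨0, le_rfl, by simp⟩
  | insert a s ha ih =>
    obtain ⟨K, hK, h⟩ := ih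
    refine ⟨(1 + |σ a|) * K + |σ a * ∑ k ∈ s, σ k|, by positivity, fun x hx hx1 => ?_⟩
    rw [Finset.prod_insert ha, Finset.sum_insert ha]
    have hfac : |1 - x * σ a| ≤ 1 + |σ a| := by
      calc |1 - x * σ a| ≤ |1| + |x * σ a| := abs_sub _ _
        _ = 1 + x * |σ a| := by rw [abs_one, abs_mul, abs_of_nonneg hx]
        _ ≤ 1 + |σ a| := by nlinarith [abs_nonneg (σ a)]
    calc |(1 - x * σ a) * ∏ k ∈ s, (1 - x * σ k) - (1 - x * (σ a + ∑ k ∈ s, σ k))|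
        = |(1 - x * σ a) * (∏ k ∈ s, (1 - x * σ k) - (1 - x * ∑ k ∈ s, σ k))
            + x ^ 2 * (σ a * ∑ k ∈ s, σ k)| := by congr 1; ring
      _ ≤ |1 - x * σ a| * |∏ k ∈ s, (1 - x * σ k) - (1 - x * ∑ k ∈ s, σ k)|
            + x ^ 2 * |σ a * ∑ k ∈ s, σ k| := by
          refine (abs_add_le _ _).trans_eq ?_
          rw [abs_mul, abs_mul (x ^ 2), abs_of_nonneg (sq_nonneg x)]
      _ ≤ (1 + |σ a|) * (K * x ^ 2) + x ^ 2 * |σ a * ∑ k ∈ s, σ k| := by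
          gcongr
          exact h x hx hx1
      _ = ((1 + |σ a|) * K + |σ a * ∑ k ∈ s, σ k|) * x ^ 2 := by ring

/-- A perturbed contraction `|y (t + 1)| ≤ (1 - a u_t) |y t| + B u_t b_{t + 1}` is `O(b)` as soon
as `b` decays slowly compared with the contraction. -/
theorem exists_eventually_abs_le_mul_of_contraction {y u b : ℕ → ℝ} {a B : ℝ}
    (ha : 0 < a) (hB : 0 ≤ B) (hu : ∀ t, 0 ≤ u t) (hb : ∀ t, 0 < b t)
    (hau : ∀ᶠ t in atTop, a * u t ≤ 1)
    (hbb : ∀ᶠ t in atTop, b t ≤ b (t + 1) * (1 + a / 2 * u t))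
    (hy : ∀ᶠ t in atTop, |y (t + 1)| ≤ (1 - a * u t) * |y t| + B * (u t * b (t + 1))) :
    ∃ C : ℝ, 0 < C ∧ ∀ᶠ t in atTop, |y t| ≤ C * b t := by
  obtain ⟨T, hT⟩ := eventually_atTop.1 (hau.and (hbb.and hy))
  have hbT := hb T
  refine ⟨2 * B / a + |y T| / b T + 1, by positivity, eventually_atTop.2 ⟨T, fun t ht => ?_⟩⟩
  set C := 2 * B / a + |y T| / b T + 1 with hC
  have hCB : B ≤ C * (a / 2) := by
    have h1 : B = 2 * B / a * (a / 2) := by field_simp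
    have h2 : 2 * B / a ≤ C := by
      have : 0 ≤ |y T| / b T := by positivity
      linarith
    calc B = 2 * B / a * (a / 2) := h1
      _ ≤ C * (a / 2) := by gcongr
  have hC0 : 0 < C := by positivity
  induction t, ht using Nat.le_induction with
  | base =>
    have h1 : |y T| = |y T| / b T * b T := by field_simp
    have h2 : |y T| / b T ≤ C := by
      have : 0 ≤ 2 * B / a := by positivity
      linarith
    calc |y T| = |y T| / b T * b T := h1
      _ ≤ C * b T := by gcongr
  | succ t ht ih =>
    obtain ⟨h1, h2, h3⟩ := hT t ht
    have hut := hu t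
    have hbt := hb (t + 1)
    have hub : 0 ≤ u t * b (t + 1) := by positivity
    calc |y (t + 1)| ≤ (1 - a * u t) * |y t| + B * (u t * b (t + 1)) := h3
      _ ≤ (1 - a * u t) * (C * (b (t + 1) * (1 + a / 2 * u t)))
            + C * (a / 2) * (u t * b (t + 1)) := by
          have h4 : |y t| ≤ C * (b (t + 1) * (1 + a / 2 * u t)) :=
            ih.trans (by gcongr)
          have h5 : 0 ≤ 1 - a * u t := by linarith
          gcongr
      _ = C * b (t + 1) - C * b (t + 1) * (a * u t) ^ 2 / 2 := by ring
      _ ≤ C * b (t + 1) := by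
          have : 0 ≤ C * b (t + 1) * (a * u t) ^ 2 / 2 := by positivity
          linarith

/-- Adding one term to a sum weighted by tail products. -/
theorem sum_range_succ_prod_Icc_mul (p f : ℕ → ℝ) (t : ℕ) :
    ∑ i ∈ Finset.range (t + 1 + 1), (∏ j ∈ Finset.Icc (i + 1) (t + 1), p j) * f i =
      p (t + 1) * ∑ i ∈ Finset.range (t + 1), (∏ j ∈ Finset.Icc (i + 1) t, p j) * f i
        + f (t + 1) := by
  rw [Finset.sum_range_succ, Finset.mul_sum]
  congr 1
  · refine Finset.sum_congr rfl fun i hi => ?_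
    have hi' := Finset.mem_range.1 hi
    rw [Finset.prod_Icc_succ_top (by lia)]
    ring
  · simp

/-- The normalised weighted sum deviates from its limit by `O((t + 1) ^ (-w))` whenever
`w ≤ v` and `w ≤ 1 - v`. -/
theorem exists_eventually_abs_weighted_sum_sub_le {φse ϕse : ℕ → ℝ} {l : ℕ} (hl : 1 ≤ l)
    {σ : Fin l → ℝ} {φ cϕ v w : ℝ}
    (hφpos : ∀ i, 0 < φse i) (hϕpos : ∀ i, 0 < ϕse i) (hσ : ∀ k, 0 < σ k)
    (hφ : Tendsto (fun i : ℕ => (i : ℝ) * (1 - φse (i - 1) / φse i)) atTop (nhds φ))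
    (hcϕ : 0 < cϕ) (hv0 : 0 < v) (hv1 : v < 1)
    (hlow : ∀ᶠ i : ℕ in atTop, cϕ / 2 * ((i : ℝ) + 1) ^ (-v) ≤ ϕse i)
    (hupp : ∀ᶠ i : ℕ in atTop, ϕse i ≤ 2 * cϕ * ((i : ℝ) + 1) ^ (-v))
    (hwv : w ≤ v) (hwv' : w ≤ 1 - v) :
    ∃ C : ℝ, 0 < C ∧ ∀ᶠ t : ℕ in atTop,
      |(φse t)⁻¹ * (∑ i ∈ Finset.range (t + 1),
          (∏ j ∈ Finset.Icc (i + 1) t, ∏ k, (1 - ϕse j * σ k)) * (ϕse i * φse i)) -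
        (∑ k, σ k)⁻¹| ≤ C * ((t : ℝ) + 1) ^ (-w) := by
  obtain ⟨K, hK, hrem⟩ := exists_abs_prod_one_sub_mul_sub_le Finset.univ σ
  set s := ∑ k, σ k with hs_def
  have hs : 0 < s := Finset.sum_pos (fun k _ => hσ k) ⟨⟨0, hl⟩, Finset.mem_univ _⟩
  set M := |φ| + 1 with hM_def
  have hM : 0 < M := by positivity
  have hnat : Tendsto (fun i : ℕ => (i : ℝ) + 1) atTop atTop :=
    tendsto_atTop_add_const_right _ _ tendsto_natCast_atTop_atTop
  have hϕ0 : Tendsto ϕse atTop (nhds 0) := by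
    have h := ((tendsto_rpow_neg_atTop hv0).comp hnat).const_mul (2 * cϕ)
    rw [mul_zero] at h
    exact tendsto_of_tendsto_of_tendsto_of_le_of_le' tendsto_const_nhds h
      (Eventually.of_forall fun i => (hϕpos i).le) hupp
  have hnϕ : Tendsto (fun i : ℕ => (i : ℝ) * ϕse i) atTop atTop := by
    have h := ((tendsto_rpow_atTop (sub_pos.2 hv1)).comp hnat).const_mul_atTop
      (show 0 < cϕ / 4 by positivity)
    refine tendsto_atTop_mono' _ ?_ h
    filter_upwards [hlow, eventually_ge_atTop 1] with i hi hi1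
    have hi1' : (1 : ℝ) ≤ i := by exact_mod_cast hi1
    have hX : (0 : ℝ) < (i : ℝ) + 1 := by positivity
    have : ((i : ℝ) + 1) ^ (1 - v) = ((i : ℝ) + 1) * ((i : ℝ) + 1) ^ (-v) := by
      rw [sub_eq_add_neg, Real.rpow_add hX, Real.rpow_one]
    simp only [Function.comp]
    calc cϕ / 4 * ((i : ℝ) + 1) ^ (1 - v)
        = ((i : ℝ) + 1) / 2 * (cϕ / 2 * ((i : ℝ) + 1) ^ (-v)) := by rw [this]; ring
      _ ≤ i * ϕse i := by
          gcongr
          linarith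
  have hinv : ∀ ε : ℝ, 0 < ε → ∀ᶠ i : ℕ in atTop, 1 / (i : ℝ) ≤ ε * ϕse i := by
    intro ε hε
    filter_upwards [hnϕ.eventually_ge_atTop (1 / ε), eventually_ge_atTop 1] with i hi hi1
    have hi1' : (0 : ℝ) < i := by exact_mod_cast hi1
    rw [div_le_iff₀ hi1']
    rw [div_le_iff₀ hε] at hi
    linarith
  have hratio : ∀ᶠ i : ℕ in atTop, |φse (i - 1) / φse i - 1| ≤ M * (1 / (i : ℝ)) := by
    have h := (hφ.abs).eventually_le_const (show |φ| < M by linarith)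
    filter_upwards [h, eventually_ge_atTop 1] with i hi hi1
    have hi1' : (0 : ℝ) < i := by exact_mod_cast hi1
    rw [mul_one_div, le_div_iff₀ hi1', abs_sub_comm]
    rw [abs_mul, abs_of_pos hi1'] at hi
    linarith
  have hshift := tendsto_add_atTop_nat 1
  refine exists_eventually_abs_le_mul_of_contraction
    (y := fun t => (φse t)⁻¹ * (∑ i ∈ Finset.range (t + 1),
      (∏ j ∈ Finset.Icc (i + 1) t, ∏ k, (1 - ϕse j * σ k)) * (ϕse i * φse i)) - s⁻¹)
    (u := fun t => ϕse (t + 1)) (b := fun t => ((t : ℝ) + 1) ^ (-w)) (a := s / 2)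
    (B := (K * (2 * cϕ) + M * (4 / cϕ)) / s)
    (by positivity) (by positivity) (fun t => (hϕpos _).le) (fun t => by positivity) ?_ ?_ ?_
  · filter_upwards [hshift.eventually
      (hϕ0.eventually_le_const (show 0 < 2 / s by positivity))] with t ht
    rw [le_div_iff₀ hs] at ht
    linarith
  · filter_upwards [hshift.eventually (hinv (s / 2 / 2) (by positivity))] with t ht
    push_cast at ht ⊢
    set X : ℝ := (t : ℝ) + 1 with hX_def
    have hX : 0 < X := by positivity
    have h1 : X ^ (-w) = (X + 1) ^ (-w) * (1 + 1 / X) ^ w := by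
      rw [show 1 + 1 / X = (X + 1) / X by field_simp, Real.div_rpow (by positivity) hX.le,
        Real.rpow_neg hX.le,
        Real.rpow_neg (show 0 ≤ X + 1 by positivity)]
      have : 0 < (X + 1) ^ w := by positivity
      field_simp
    rw [h1]
    have h2 : (1 + 1 / X) ^ w ≤ 1 + 1 / X := by
      have h3 : 1 ≤ 1 + 1 / X := by
        have : 0 < 1 / X := by positivity
        linarith
      calc (1 + 1 / X) ^ w ≤ (1 + 1 / X) ^ (1 : ℝ) :=
            Real.rpow_le_rpow_of_exponent_le h3 (by linarith)
        _ = 1 + 1 / X := Real.rpow_one _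
    gcongr
    linarith
  · have hε : 0 < min 1 (min (1 / s) (s / (4 * (K + 1)))) := by positivity
    filter_upwards [hshift.eventually (hϕ0.eventually_le_const hε),
      hshift.eventually (hinv (s / (4 * M)) (by positivity)), hshift.eventually hratio,
      hshift.eventually hlow, hshift.eventually hupp] with t hsmall hinvt hr hlo hup
    rw [sum_range_succ_prod_Icc_mul (fun j => ∏ k, (1 - ϕse j * σ k))]
    set S := ∑ i ∈ Finset.range (t + 1),
      (∏ j ∈ Finset.Icc (i + 1) t, ∏ k, (1 - ϕse j * σ k)) * (ϕse i * φse i)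
    have hxpos := hϕpos (t + 1)
    have hremt := hrem (ϕse (t + 1)) hxpos.le (hsmall.trans (min_le_left _ _))
    have hP0 : 0 ≤ ∏ k, (1 - ϕse (t + 1) * σ k) ∧ ∏ k, (1 - ϕse (t + 1) * σ k) ≤ 1 := by
      have hxs : ϕse (t + 1) * s ≤ 1 := by
        have := hsmall.trans ((min_le_right _ _).trans (min_le_left _ _))
        rwa [le_div_iff₀ hs] at this
      have hk : ∀ k, ϕse (t + 1) * σ k ≤ 1 := fun k =>
        (mul_le_mul_of_nonneg_left
          (Finset.single_le_sum (fun i _ => (hσ i).le) (Finset.mem_univ k)) hxpos.le).trans hxs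
      refine ⟨Finset.prod_nonneg fun k _ => by linarith [hk k],
        Finset.prod_le_one (fun k _ => by linarith [hk k]) fun k _ => ?_⟩
      have := mul_pos hxpos (hσ k)
      linarith
    have hsm : K * ϕse (t + 1) ≤ s / 4 := by
      have h1 := hsmall.trans ((min_le_right _ _).trans (min_le_right _ _))
      rw [le_div_iff₀ (by positivity)] at h1
      linarith
    set x := ϕse (t + 1)
    set P := ∏ k, (1 - x * σ k)
    have hφt := hφpos t
    have hφt1 := hφpos (t + 1)
    rw [Nat.add_sub_cancel] at hr
    set r := φse t / φse (t + 1) with hr_def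
    have hr0 : 0 ≤ r := by positivity
    push_cast at hinvt hr hlo hup ⊢
    set X : ℝ := (t : ℝ) + 1 with hX_def
    have hX : 1 ≤ X := by simp [hX_def]
    obtain ⟨hP0, hP1⟩ := hP0
    set R := P - (1 - x * s) with hR_def
    have hPr : P * r ≤ 1 - s / 2 * x := by
      have e1 : P * r - (1 - x * s) = R + P * (r - 1) := by ring
      have e2 : P * (r - 1) ≤ s / 4 * x := by
        calc P * (r - 1) ≤ P * |r - 1| := by gcongr; exact le_abs_self _
          _ ≤ 1 * (M * (1 / X)) := by gcongr
          _ ≤ 1 * (M * (s / (4 * M) * x)) := by gcongr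
          _ = s / 4 * x := by field_simp
      have e3 : R ≤ s / 4 * x := by
        calc R ≤ K * x ^ 2 := (le_abs_self _).trans hremt
          _ = K * x * x := by ring
          _ ≤ s / 4 * x := by gcongr
      linarith
    have hbX : x ≤ 2 * cϕ * (X + 1) ^ (-w) := by
      refine hup.trans ?_
      gcongr
      · linarith
    have hXinv : 1 / X ≤ 4 / cϕ * (x * (X + 1) ^ (-w)) := by
      have h1 : (X + 1) ^ (-1 : ℝ) ≤ (X + 1) ^ (-v) * (X + 1) ^ (-w) := by
        rw [← Real.rpow_add (by linarith)]
        exact Real.rpow_le_rpow_of_exponent_le (by linarith) (by linarith)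
      rw [Real.rpow_neg_one] at h1
      calc 1 / X ≤ 2 * (X + 1)⁻¹ := by
            rw [← div_eq_mul_inv, div_le_div_iff₀ (by linarith) (by linarith)]
            linarith
        _ ≤ 2 * ((X + 1) ^ (-v) * (X + 1) ^ (-w)) := by gcongr
        _ = 4 / cϕ * ((cϕ / 2 * (X + 1) ^ (-v)) * (X + 1) ^ (-w)) := by field_simp; ring
        _ ≤ 4 / cϕ * (x * (X + 1) ^ (-w)) := by gcongr
    have hrec : (φse (t + 1))⁻¹ * (P * S + x * φse (t + 1)) - s⁻¹
        = P * r * ((φse t)⁻¹ * S - s⁻¹) + (R + P * (r - 1)) / s := by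
      rw [hR_def, hr_def]
      field_simp
      ring
    have herr : |(R + P * (r - 1)) / s|
        ≤ (K * (2 * cϕ) + M * (4 / cϕ)) / s * (x * (X + 1) ^ (-w)) := by
      rw [abs_div, abs_of_pos hs, div_mul_eq_mul_div]
      gcongr
      calc |R + P * (r - 1)| ≤ |R| + P * |r - 1| := by
            refine (abs_add_le _ _).trans_eq ?_
            rw [abs_mul, abs_of_nonneg hP0]
        _ ≤ K * x ^ 2 + 1 * (M * (1 / X)) := by gcongr
        _ = K * (x * x) + M * (1 / X) := by ring
        _ ≤ K * (x * (2 * cϕ * (X + 1) ^ (-w))) + M * (4 / cϕ * (x * (X + 1) ^ (-w))) := by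
            gcongr
        _ = (K * (2 * cϕ) + M * (4 / cϕ)) * (x * (X + 1) ^ (-w)) := by ring
    rw [hrec]
    calc |P * r * ((φse t)⁻¹ * S - s⁻¹) + (R + P * (r - 1)) / s|
        ≤ P * r * |(φse t)⁻¹ * S - s⁻¹| + |(R + P * (r - 1)) / s| := by
          refine (abs_add_le _ _).trans_eq ?_
          rw [abs_mul, abs_of_nonneg (mul_nonneg hP0 hr0)]
      _ ≤ _ := by gcongr

/-- **Rate version of the series lemma** (Lemma C.2 of the paper).
Let `(φ_i)` be positive with `i (1 − φ_{i-1}/φ_i) → φ < 0`, let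
`ϕ_i = c_ϕ/(i+1)^v + o(1/(i+1)^v)` (i.e. `(i+1)^v ϕ_i → c_ϕ`) with `c_ϕ > 0`, `v ∈ (0,1)`,
and let `σ_1, …, σ_l > 0`.  With
`D_t = |(1/φ_t) ∑_{i=0}^t ∏_{j=i+1}^t ∏_k (1 − ϕ_j σ_k) ϕ_i φ_i − 1/∑_k σ_k|`,
there is a constant `c > 0` independent of `t` such that for all large `t`:
`D_t ≤ c ϕ_t` if `v < 1/2`; `D_t ≤ c (1/2 − (φ/c_ϕ²)/(∑σ)²) ϕ_t` if `v = 1/2`;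
and `D_t ≤ c (−φ/(∑σ)²) (1/(t ϕ_t))` if `v > 1/2`. -/
theorem series_rate_lemma (φse ϕse : ℕ → ℝ) (l : ℕ) (hl : 1 ≤ l) (σ : Fin l → ℝ)
    (φ cϕ v : ℝ)
    (hφpos : ∀ i, 0 < φse i) (hϕpos : ∀ i, 0 < ϕse i) (hσ : ∀ k, 0 < σ k)
    (hφ : Tendsto (fun i : ℕ => (i : ℝ) * (1 - φse (i - 1) / φse i)) atTop (nhds φ))
    (hφneg : φ < 0) (hcϕ : 0 < cϕ) (hv : 0 < v ∧ v < 1)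
    (hϕ : Tendsto (fun i : ℕ => ((i : ℝ) + 1) ^ v * ϕse i) atTop (nhds cϕ)) :
    ∃ c : ℝ, 0 < c ∧
      ((v < 1 / 2 → ∀ᶠ t : ℕ in atTop,
        |(φse t)⁻¹ * (∑ i ∈ Finset.range (t + 1),
            (∏ j ∈ Finset.Icc (i + 1) t, ∏ k, (1 - ϕse j * σ k)) * (ϕse i * φse i)) -
          (∑ k, σ k)⁻¹| ≤ c * ϕse t) ∧
      (v = 1 / 2 → ∀ᶠ t : ℕ in atTop,
        |(φse t)⁻¹ * (∑ i ∈ Finset.range (t + 1),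
            (∏ j ∈ Finset.Icc (i + 1) t, ∏ k, (1 - ϕse j * σ k)) * (ϕse i * φse i)) -
          (∑ k, σ k)⁻¹| ≤ c * ((1 / 2 - (φ / cϕ ^ 2) / (∑ k, σ k) ^ 2) * ϕse t)) ∧
      (1 / 2 < v → ∀ᶠ t : ℕ in atTop,
        |(φse t)⁻¹ * (∑ i ∈ Finset.range (t + 1),
            (∏ j ∈ Finset.Icc (i + 1) t, ∏ k, (1 - ϕse j * σ k)) * (ϕse i * φse i)) -
          (∑ k, σ k)⁻¹| ≤ c * (-φ / (∑ k, σ k) ^ 2 * ((t : ℝ) * ϕse t)⁻¹))) := by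
  obtain ⟨hv0, hv1⟩ := hv
  have hs : 0 < ∑ k, σ k := Finset.sum_pos (fun k _ => hσ k) ⟨⟨0, hl⟩, Finset.mem_univ _⟩
  have hresc : ∀ i : ℕ, ϕse i = ((i : ℝ) + 1) ^ v * ϕse i * ((i : ℝ) + 1) ^ (-v) := by
    intro i
    have : (0 : ℝ) < ((i : ℝ) + 1) ^ v := by positivity
    rw [Real.rpow_neg (by positivity)]
    field_simp
  have hlow : ∀ᶠ i : ℕ in atTop, cϕ / 2 * ((i : ℝ) + 1) ^ (-v) ≤ ϕse i := by
    filter_upwards [hϕ.eventually_const_le (show cϕ / 2 < cϕ by linarith)] with i hi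
    rw [hresc i]
    gcongr
  have hupp : ∀ᶠ i : ℕ in atTop, ϕse i ≤ 2 * cϕ * ((i : ℝ) + 1) ^ (-v) := by
    filter_upwards [hϕ.eventually_le_const (show cϕ < 2 * cϕ by linarith)] with i hi
    rw [hresc i]
    gcongr
  rcases le_or_gt v (1 / 2) with hvle | hvgt
  · obtain ⟨C, hC, hD⟩ := exists_eventually_abs_weighted_sum_sub_le hl hφpos hϕpos hσ hφ hcϕ
      hv0 hv1 hlow hupp le_rfl (by linarith)
    set A := 1 / 2 - (φ / cϕ ^ 2) / (∑ k, σ k) ^ 2 with hA_def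
    have hA : 0 < A := by
      have : φ / cϕ ^ 2 / (∑ k, σ k) ^ 2 < 0 :=
        div_neg_of_neg_of_pos (div_neg_of_neg_of_pos hφneg (by positivity)) (by positivity)
      linarith
    have key : ∀ᶠ t : ℕ in atTop, C * ((t : ℝ) + 1) ^ (-v) ≤ C * (2 / cϕ) * ϕse t := by
      filter_upwards [hlow] with t ht
      calc C * ((t : ℝ) + 1) ^ (-v) = C * (2 / cϕ) * (cϕ / 2 * ((t : ℝ) + 1) ^ (-v)) := by
            field_simp
        _ ≤ C * (2 / cϕ) * ϕse t := by gcongr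
    refine ⟨C * (2 / cϕ) + C * (2 / cϕ) / A, by positivity, fun _ => ?_, fun _ => ?_,
      fun h => absurd h (by linarith)⟩
    · filter_upwards [hD, key] with t h1 h2
      have h3 : 0 < C * (2 / cϕ) / A * ϕse t := mul_pos (by positivity) (hϕpos t)
      linarith
    · filter_upwards [hD, key] with t h1 h2
      have h3 : 0 < C * (2 / cϕ) * (A * ϕse t) := mul_pos (by positivity) (mul_pos hA (hϕpos t))
      have h4 : C * (2 / cϕ) / A * (A * ϕse t) = C * (2 / cϕ) * ϕse t := by field_simp
      linarith
  · obtain ⟨C, hC, hD⟩ := exists_eventually_abs_weighted_sum_sub_le hl hφpos hϕpos hσ hφ hcϕ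
      hv0 hv1 hlow hupp (by linarith) le_rfl
    set A := -φ / (∑ k, σ k) ^ 2 with hA_def
    have hA : 0 < A := div_pos (by linarith) (by positivity)
    refine ⟨C * (2 * cϕ) / A, by positivity, fun h => absurd h (by linarith),
      fun h => absurd h (by linarith), fun _ => ?_⟩
    filter_upwards [hD, hupp, eventually_ge_atTop 1] with t h1 h2 ht
    have ht' : (0 : ℝ) < t := by exact_mod_cast ht
    have htϕ : 0 < (t : ℝ) * ϕse t := mul_pos ht' (hϕpos t)
    refine h1.trans ?_
    have h3 : C * (2 * cϕ) / A * (A * ((t : ℝ) * ϕse t)⁻¹) = C * (2 * cϕ) / (t * ϕse t) := by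
      rw [← mul_assoc, div_mul_cancel₀ _ hA.ne', div_eq_mul_inv]
    rw [h3, le_div_iff₀ htϕ, mul_assoc]
    refine mul_le_mul_of_nonneg_left ?_ hC.le
    have hϕt := hϕpos t
    have hX : (0 : ℝ) < (t : ℝ) + 1 := by positivity
    have h4 : ((t : ℝ) + 1) ^ (-(1 - v)) * (((t : ℝ) + 1) * ((t : ℝ) + 1) ^ (-v)) = 1 := by
      rw [← Real.rpow_one_add' hX.le (by linarith), ← Real.rpow_add hX]
      simp [sub_eq_add_neg]
    calc ((t : ℝ) + 1) ^ (-(1 - v)) * (t * ϕse t)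
        ≤ ((t : ℝ) + 1) ^ (-(1 - v)) *
            (((t : ℝ) + 1) * (2 * cϕ * ((t : ℝ) + 1) ^ (-v))) := by
          gcongr
          linarith
      _ = 2 * cϕ * (((t : ℝ) + 1) ^ (-(1 - v)) *
            (((t : ℝ) + 1) * ((t : ℝ) + 1) ^ (-v))) := by ring
      _ = 2 * cϕ := by rw [h4, mul_one]
end

section
/- Under Assumptions (A1)–(A4), if τ ≥ log(γ_H/(4Υ_H))/log ρ with ρ = 1 − γ_S, β ∈ (0, 1), χ > β, and c_β, c_χ > 0, then there exists a constant c > 0 independent of k such that for all k: E[‖θ̂^k‖²] ≤ c( (Υ_H²/γ_H²) E[‖x_k − x*‖²] + (τ²Υ_S C_{g,2}^{1/2}/γ_H⁴) E[‖B_k − B*‖²] ), where θ̂^k = θ^k − θ̃^k is the difference between the martingale difference of the sketched Newton direction and its i.i.d. approximation formed at x*. -/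
open MeasureTheory ProbabilityTheory Filter Matrix
open scoped ENNReal RealInnerProductSpace

noncomputable section

/-- Euclidean vectors in `ℝ^d` (with the `ℓ2` norm). -/
abbrev EV (d : ℕ) := EuclideanSpace ℝ (Fin d)

/-- Square `d × d` real matrices. -/
abbrev Mat (d : ℕ) := Matrix (Fin d) (Fin d) ℝ

/-- `d × q` real (sketching) matrices. -/
abbrev SkMat (d q : ℕ) := Matrix (Fin d) (Fin q) ℝ

instance matMS (m n α : Type*) [MeasurableSpace α] : MeasurableSpace (Matrix m n α) :=
  (inferInstance : MeasurableSpace (m → n → α))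

/-- A matrix acting on Euclidean space. -/
def mv {d : ℕ} (A : Mat d) (v : EV d) : EV d := Matrix.toEuclideanLin A v

/-- Spectral norm (operator `ℓ2 → ℓ2` norm) of a rectangular real matrix. -/
def specNorm {m n : ℕ} (A : Matrix (Fin m) (Fin n) ℝ) : ℝ :=
  ‖LinearMap.toContinuousLinearMap (Matrix.toEuclideanLin A)‖

/-- Entrywise (Bochner) integral of a matrix-valued map. -/
def mInt {α : Type*} [MeasurableSpace α] (ν : Measure α) {m n : ℕ}
    (A : α → Matrix (Fin m) (Fin n) ℝ) : Matrix (Fin m) (Fin n) ℝ :=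
  Matrix.of fun i j => ∫ a, A a i j ∂ν

/-- Outer product `v wᵀ` of Euclidean vectors. -/
def outerProd {d : ℕ} (v w : EV d) : Mat d := Matrix.of fun i j => v i * w j

/-- The four Penrose conditions characterizing the Moore–Penrose pseudoinverse `Ad` of `A`. -/
def IsMoorePenrose {m n : ℕ} (A : Matrix (Fin m) (Fin n) ℝ)
    (Ad : Matrix (Fin n) (Fin m) ℝ) : Prop :=
  A * Ad * A = A ∧ Ad * A * Ad = Ad ∧ (A * Ad)ᵀ = A * Ad ∧ (Ad * A)ᵀ = Ad * A

/-- `B S (Sᵀ B² S)† Sᵀ B`, the sketch-induced projection matrix. -/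
def skProj {d q : ℕ} (pinvq : Matrix (Fin q) (Fin q) ℝ → Matrix (Fin q) (Fin q) ℝ)
    (B : Mat d) (s : SkMat d q) : Mat d :=
  B * s * pinvq (sᵀ * (B * B) * s) * sᵀ * B

/-- Ordered matrix product `f b * f (b-1) * ⋯ * f a` (equal to `1` if `b < a`),
matching the convention `∏_{k=a}^b A_k = A_b A_{b-1} ⋯ A_a`. -/
def mprodRev {d : ℕ} (f : ℕ → Mat d) (a b : ℕ) : Mat d :=
  (((List.range' a (b + 1 - a)).reverse).map f).prod

/-- The setting of the online sketched Newton method of Na–Mangoubi (2022) /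
Kuang–Anitescu–Na (2025), together with Assumptions (A1)–(A4) of the paper.

* `d` : problem dimension; `q` : sketch dimension; `τ` : number of sketching steps;
* `Ω` : underlying probability space carrying all randomness, with probability measure `μ`;
* `Ξs` : sample space of the data `ξ ∼ P`. -/
structure SNSetting (d q τ : ℕ) (Ω : Type*) [mΩ : MeasurableSpace Ω] (μ : Measure Ω)
    (Ξs : Type*) [MeasurableSpace Ξs] where
  /-- the noisy objective `f(x; ξ)` -/
  f : EV d → Ξs → ℝ
  /-- the population distribution `P` of the data -/
  P : Measure Ξs
  hP : IsProbabilityMeasure P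
  hμ : IsProbabilityMeasure μ
  /-- the population objective `F(x) = E_{ξ∼P}[f(x;ξ)]` -/
  F : EV d → ℝ
  hF : ∀ x, F x = ∫ ξv, f x ξv ∂P
  /-- the true model parameter: the unique minimizer of `F` -/
  xstar : EV d
  hxstar : ∀ y, y ≠ xstar → F xstar < F y
  /-- gradient of `f(·;ξ)` -/
  gradf : EV d → Ξs → EV d
  /-- Hessian of `f(·;ξ)` -/
  Hessf : EV d → Ξs → Mat d
  /-- gradient of `F` -/
  gradF : EV d → EV d
  /-- Hessian of `F` -/
  HessF : EV d → Mat d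
  hgradf : ∀ ξv x, HasGradientAt (fun y => f y ξv) (gradf x ξv) x
  hHessf : ∀ ξv x, HasFDerivAt (fun y => gradf y ξv)
    (LinearMap.toContinuousLinearMap (Matrix.toEuclideanLin (Hessf x ξv))) x
  hHessfCont : ∀ ξv, Continuous fun x => Hessf x ξv
  hgradF : ∀ x, HasGradientAt F (gradF x) x
  hHessF : ∀ x, HasFDerivAt gradF
    (LinearMap.toContinuousLinearMap (Matrix.toEuclideanLin (HessF x))) x
  hHessFCont : Continuous HessF
  /-- `∇F(x) = E[∇f(x;ξ)]` (uniform integrability of the stochastic gradients) -/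
  hgradFP : ∀ x i, gradF x i = ∫ ξv, gradf x ξv i ∂P
  -- constants of the assumptions and of the stepsize schedule
  (ΥL γH ΥH γS ΥS Cg1 Cg2 CH1 CH2 : ℝ)
  (cβ cχ β χ : ℝ)
  hΥL : 0 < ΥL
  hγH : 0 < γH
  hγΥ : γH ≤ ΥH
  hγS : 0 < γS
  hγS1 : γS ≤ 1
  hΥS : 0 < ΥS
  hCg1 : 0 < Cg1
  hCg2 : 0 < Cg2
  hCH1 : 0 < CH1
  hCH2 : 0 < CH2
  hcβ : 0 < cβ
  hcχ : 0 < cχ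
  /-- Assumption (A1): `∇²F` is `ΥL`-Lipschitz (in spectral norm). -/
  hA1 : ∀ x y, specNorm (HessF x - HessF y) ≤ ΥL * ‖x - y‖
  /-- Assumption (A2): fourth-moment growth condition on the gradient noise. -/
  hA2 : ∀ x, ∫⁻ ξv, ENNReal.ofReal (‖gradf x ξv - gradF x‖ ^ 4) ∂P
      ≤ ENNReal.ofReal (Cg1 * ‖x - xstar‖ ^ 4 + Cg2)
  /-- Assumption (A3): `γH I ⪯ ∇²f(x;ξ) ⪯ ΥH I`. -/
  hA3a : ∀ x ξv, (Hessf x ξv - γH • (1 : Mat d)).PosSemidef ∧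
      (ΥH • (1 : Mat d) - Hessf x ξv).PosSemidef
  hA3sym : ∀ x ξv, (Hessf x ξv).IsSymm
  /-- Assumption (A3): fourth-moment growth condition on the Hessian noise. -/
  hA3b : ∀ x, ∫⁻ ξv, ENNReal.ofReal (specNorm (Hessf x ξv - HessF x) ^ 4) ∂P
      ≤ ENNReal.ofReal (CH1 * ‖x - xstar‖ ^ 4 + CH2)
  /-- Moore–Penrose pseudoinverse on `q × q` matrices (data with the Penrose axioms). -/
  pinvq : Matrix (Fin q) (Fin q) ℝ → Matrix (Fin q) (Fin q) ℝ
  hpinvq : ∀ A, IsMoorePenrose A (pinvq A)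
  /-- Moore–Penrose pseudoinverse of `d × q` sketching matrices. -/
  pinvS : SkMat d q → Matrix (Fin q) (Fin d) ℝ
  hpinvS : ∀ A, IsMoorePenrose A (pinvS A)
  /-- the sketching distribution `S ∼ 𝒮` -/
  Psk : Measure (SkMat d q)
  hPsk : IsProbabilityMeasure Psk
  /-- Assumption (A4): `E[‖S‖²‖S†‖²] ≤ ΥS`. -/
  hA4b : ∫⁻ s, ENNReal.ofReal (specNorm s ^ 2 * specNorm (pinvS s) ^ 2) ∂Psk
      ≤ ENNReal.ofReal ΥS
  -- the stochastic processes of the method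
  /-- `𝔉 t` is the σ-algebra of all information available before sampling at time `t`
  (denoted `F_{t-1}` in the paper). -/
  𝔉 : ℕ → MeasurableSpace Ω
  h𝔉le : ∀ t, 𝔉 t ≤ mΩ
  h𝔉mono : Monotone 𝔉
  /-- the i.i.d. samples `ξ_t ∼ P` -/
  ξ : ℕ → Ω → Ξs
  /-- the i.i.d. sketching matrices `S_{t,j} ∼ 𝒮` -/
  S : ℕ → ℕ → Ω → SkMat d q
  /-- the (possibly random, adaptive) stepsizes `ᾱ_t` -/
  αbar : ℕ → Ω → ℝ
  /-- the iterates `x_t` -/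
  x : ℕ → Ω → EV d
  /-- the averaged Hessian estimates `B_t` -/
  B : ℕ → Ω → Mat d
  /-- the inner sketching-solver iterates `Δx_{t,j}` -/
  Δ : ℕ → ℕ → Ω → EV d
  hmeasξ : ∀ t, Measurable (ξ t)
  hmeasS : ∀ t j, Measurable (S t j)
  hxadapt : ∀ t, Measurable[𝔉 t] (x t)
  hBadapt : ∀ t, Measurable[𝔉 t] (B t)
  hξnext : ∀ t, MeasurableSpace.comap (ξ t) inferInstance ≤ 𝔉 (t + 1)
  hSnext : ∀ t j, MeasurableSpace.comap (S t j) inferInstance ≤ 𝔉 (t + 1)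
  hαnext : ∀ t, Measurable[𝔉 (t + 1)] (αbar t)
  hdistξ : ∀ t, Measure.map (ξ t) μ = P
  hdistS : ∀ t j, Measure.map (S t j) μ = Psk
  /-- `ξ_t` is independent of the past. -/
  hindepξ : ∀ t, Indep (MeasurableSpace.comap (ξ t) inferInstance) (𝔉 t) μ
  /-- `S_{t,j}` is independent of the past, of `ξ_t`, and of the previous sketches. -/
  hindepS : ∀ t j, Indep (MeasurableSpace.comap (S t j) inferInstance)
      (𝔉 t ⊔ MeasurableSpace.comap (ξ t) inferInstance ⊔
        ⨆ j' ∈ Finset.range j, MeasurableSpace.comap (S t j') inferInstance) μ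
  /-- Assumption (A4): `E[B_t S (Sᵀ B_t² S)† Sᵀ B_t | F_{t-1}] ⪰ γS I` along the trajectory. -/
  hA4a : ∀ t, ∀ᵐ ω ∂μ, (mInt Psk (fun s => skProj pinvq (B t ω) s) - γS • (1 : Mat d)).PosSemidef
  -- the dynamics
  hB0 : ∀ ω, B 0 ω = 1
  hBt : ∀ t ω, 1 ≤ t → B t ω = (t : ℝ)⁻¹ • ∑ i ∈ Finset.range t, Hessf (x i ω) (ξ i ω)
  hΔ0 : ∀ t ω, Δ t 0 ω = 0
  hΔrec : ∀ t j ω, Δ t (j + 1) ω = Δ t j ω -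
      mv (B t ω * S t j ω * pinvq ((S t j ω)ᵀ * (B t ω * B t ω) * S t j ω) * (S t j ω)ᵀ)
        (mv (B t ω) (Δ t j ω) + gradf (x t ω) (ξ t ω))
  hα : ∀ (t : ℕ) (ω : Ω), cβ / ((t : ℝ) + 1) ^ β ≤ αbar t ω ∧
      αbar t ω ≤ cβ / ((t : ℝ) + 1) ^ β + cχ / ((t : ℝ) + 1) ^ χ
  hxrec : ∀ t ω, x (t + 1) ω = x t ω + αbar t ω • Δ t τ ω

namespace SNSetting

variable {d q τ : ℕ} {Ω : Type*} [mΩ : MeasurableSpace Ω] {μ : Measure Ω}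
  {Ξs : Type*} [MeasurableSpace Ξs] (st : SNSetting d q τ Ω μ Ξs)

/-- `β_t = c_β/(t+1)^β`. -/
def βt (t : ℕ) : ℝ := st.cβ / ((t : ℝ) + 1) ^ st.β

/-- `χ_t = c_χ/(t+1)^χ`. -/
def χt (t : ℕ) : ℝ := st.cχ / ((t : ℝ) + 1) ^ st.χ

/-- the centered stepsize `φ_t = β_t + χ_t/2`. -/
def φt (t : ℕ) : ℝ := st.βt t + st.χt t / 2

/-- the approximate Newton direction `Δ̄x_t = Δx_{t,τ}`. -/
def Δbar (t : ℕ) (ω : Ω) : EV d := st.Δ t τ ω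

/-- `B* = ∇²F(x*)`. -/
def Bstar : Mat d := st.HessF st.xstar

/-- `C* = (I − E[B* S (Sᵀ (B*)² S)† Sᵀ B*])^τ = E[C̃*]`. -/
def Cstar : Mat d := ((1 : Mat d) - mInt st.Psk (fun s => skProj st.pinvq st.Bstar s)) ^ τ

/-- `E[∇f(x*;ξ) ∇f(x*;ξ)ᵀ]`. -/
def Gram : Mat d := Matrix.of fun i j => ∫ ξv, st.gradf st.xstar ξv i * st.gradf st.xstar ξv j ∂st.P

/-- `Ω* = (B*)⁻¹ E[∇f(x*;ξ) ∇f(x*;ξ)ᵀ] (B*)⁻¹`. -/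
def Ωstar : Mat d := st.Bstar⁻¹ * st.Gram * st.Bstar⁻¹

/-- `C̃*` as a function of `τ` i.i.d. sketches: `∏_{j=1}^τ (I − B* S_j (S_jᵀ (B*)² S_j)† S_jᵀ B*)`
(factors applied in decreasing index order). -/
def CtilStarFn (s : Fin τ → SkMat d q) : Mat d :=
  ((List.ofFn fun k : Fin τ => (1 : Mat d) - skProj st.pinvq st.Bstar (s k)).reverse).prod

/-- The right-hand side `E[(I − C̃*) Ω* (I − C̃*)ᵀ]` of the Lyapunov equation. -/
def Λmat : Mat d :=
  letI := st.hPsk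
  mInt (Measure.pi fun _ : Fin τ => st.Psk)
    (fun s => ((1 : Mat d) - st.CtilStarFn s) * st.Ωstar * ((1 : Mat d) - st.CtilStarFn s)ᵀ)

/-- the running average `x̄_t = (1/t) ∑_{i=1}^t x_i`. -/
def xbar (t : ℕ) (ω : Ω) : EV d := (t : ℝ)⁻¹ • ∑ i ∈ Finset.range t, st.x (i + 1) ω

/-- the weighted sample covariance estimator
`Ξ̂_t = (1/t) ∑_{i=1}^t (1/φ_{i-1}) (x_i − x̄_t)(x_i − x̄_t)ᵀ`. -/
def Ξhat (t : ℕ) (ω : Ω) : Mat d :=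
  (t : ℝ)⁻¹ • ∑ i ∈ Finset.range t,
    (st.φt i)⁻¹ • outerProd (st.x (i + 1) ω - st.xbar t ω) (st.x (i + 1) ω - st.xbar t ω)

/-- `C̃_t = ∏_{j=1}^τ (I − B_t S_{t,j} (S_{t,j}ᵀ B_t² S_{t,j})† S_{t,j}ᵀ B_t)`. -/
def Ctil (t : ℕ) (ω : Ω) : Mat d :=
  ((List.ofFn fun j : Fin τ => (1 : Mat d) - skProj st.pinvq (st.B t ω) (st.S t j ω)).reverse).prod

/-- `C_t = E[C̃_t | F_{t-1}]` (entrywise conditional expectation). -/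
def Cmat (t : ℕ) (ω : Ω) : Mat d :=
  Matrix.of fun i j => (μ[(fun ω' => st.Ctil t ω' i j)|st.𝔉 t]) ω

/-- the martingale-difference part `θ^k = Δ̄x_k − E[Δ̄x_k | F_{k-1}]`. -/
def θv (k : ℕ) (ω : Ω) : EV d :=
  (EuclideanSpace.equiv (Fin d) ℝ).symm
    fun i => st.Δbar k ω i - (μ[(fun ω' => st.Δbar k ω' i)|st.𝔉 k]) ω

/-- `ψ^i = ∇F(x_i) − B*(x_i − x*)`. -/
def ψv (i : ℕ) (ω : Ω) : EV d := st.gradF (st.x i ω) - mv st.Bstar (st.x i ω - st.xstar)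

/-- `δ^i = −(I − C_i){(B*)⁻¹ψ^i + (B_i⁻¹ − (B*)⁻¹)∇F_i} + (C_i − C*)(x_i − x*)`. -/
def δv (i : ℕ) (ω : Ω) : EV d :=
  -(mv ((1 : Mat d) - st.Cmat i ω)
      (mv st.Bstar⁻¹ (st.ψv i ω) + mv ((st.B i ω)⁻¹ - st.Bstar⁻¹) (st.gradF (st.x i ω)))) +
    mv (st.Cmat i ω - st.Cstar) (st.x i ω - st.xstar)

/-- `∏_{j=a}^{b} (I − φ_j (I − C*))` (decreasing index order). -/
def Φprod (a b : ℕ) : Mat d :=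
  mprodRev (fun j => (1 : Mat d) - st.φt j • ((1 : Mat d) - st.Cstar)) a b

/-- `I_{1,t} = ∑_{i=0}^t ∏_{j=i+1}^t (I − φ_j(I − C*)) φ_i θ^i`. -/
def I1 (t : ℕ) (ω : Ω) : EV d :=
  ∑ i ∈ Finset.range (t + 1), st.φt i • mv (st.Φprod (i + 1) t) (st.θv i ω)

/-- `I_{2,t} = ∑_{i=0}^t ∏_{j=i+1}^t (I − φ_j(I − C*)) (ᾱ_i − φ_i) Δ̄x_i`. -/
def I2 (t : ℕ) (ω : Ω) : EV d :=
  ∑ i ∈ Finset.range (t + 1), (st.αbar i ω - st.φt i) • mv (st.Φprod (i + 1) t) (st.Δbar i ω)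

/-- `I_{3,t} = ∏_{i=0}^t (I − φ_i(I − C*)) (x_0 − x*) + ∑_{i=0}^t ∏_{j=i+1}^t (I − φ_j(I − C*)) φ_i δ^i`. -/
def I3 (t : ℕ) (ω : Ω) : EV d :=
  mv (st.Φprod 0 t) (st.x 0 ω - st.xstar) +
    ∑ i ∈ Finset.range (t + 1), st.φt i • mv (st.Φprod (i + 1) t) (st.δv i ω)

/-- `C̃*_k`: the product of the `τ` sketch-induced projection complements formed at `B*`
from the same sketching matrices used at iteration `k`. -/
def CtilStar (k : ℕ) (ω : Ω) : Mat d :=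
  ((List.ofFn fun j : Fin τ => (1 : Mat d) - skProj st.pinvq st.Bstar (st.S k j ω)).reverse).prod

/-- the i.i.d. approximation `θ̃^k = −(I − C̃*_k)(B*)⁻¹ ∇f(x*; ξ_k)`. -/
def θtil (k : ℕ) (ω : Ω) : EV d :=
  -(mv (((1 : Mat d) - st.CtilStar k ω) * st.Bstar⁻¹) (st.gradf st.xstar (st.ξ k ω)))

/-- `θ̂^k = θ^k − θ̃^k`. -/
def θhat (k : ℕ) (ω : Ω) : EV d := st.θv k ω - st.θtil k ω

/-- `Ĩ_{1,t}`: `I_{1,t}` with `θ̃^k` in place of `θ^k`. -/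
def I1til (t : ℕ) (ω : Ω) : EV d :=
  ∑ i ∈ Finset.range (t + 1), st.φt i • mv (st.Φprod (i + 1) t) (st.θtil i ω)

/-- `Î_{1,t}`: `I_{1,t}` with `θ̂^k` in place of `θ^k`. -/
def I1hat (t : ℕ) (ω : Ω) : EV d :=
  ∑ i ∈ Finset.range (t + 1), st.φt i • mv (st.Φprod (i + 1) t) (st.θhat i ω)

end SNSetting
end

section LinearAlgebra

open scoped Matrix.Norms.L2Operator

variable {d : ℕ}

lemma mv_mul (A B : Mat d) (v : EV d) : mv (A * B) v = mv A (mv B v) := by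
  simp [mv, Matrix.toLpLin_mul_same]

lemma mv_one (v : EV d) : mv (1 : Mat d) v = v := by
  simp [mv]

lemma mv_add (A : Mat d) (v w : EV d) : mv A (v + w) = mv A v + mv A w := by
  simp [mv]

lemma mv_sub (A : Mat d) (v w : EV d) : mv A (v - w) = mv A v - mv A w := by
  simp [mv]

lemma mv_neg (A : Mat d) (v : EV d) : mv A (-v) = -mv A v := by
  simp [mv]

lemma sub_mv (A B : Mat d) (v : EV d) : mv (A - B) v = mv A v - mv B v := by
  simp [mv]

lemma smul_one_mv (a : ℝ) (v : EV d) : mv (a • (1 : Mat d)) v = a • v := by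
  simp [mv]

lemma smul_sum_mv {ι : Type*} (s : Finset ι) (a : ℝ) (A : ι → Mat d) (v : EV d) :
    mv (a • ∑ i ∈ s, A i) v = a • ∑ i ∈ s, mv (A i) v := by
  simp [mv]

lemma mv_apply (A : Mat d) (v : EV d) (i : Fin d) : mv A v i = ∑ j, A i j * v j := by
  simp [mv, Matrix.toLpLin_apply, Matrix.mulVec, dotProduct]

lemma specNorm_eq_norm {m n : ℕ} (A : Matrix (Fin m) (Fin n) ℝ) : specNorm A = ‖A‖ := rfl

lemma norm_mv_le (A : Mat d) (v : EV d) : ‖mv A v‖ ≤ ‖A‖ * ‖v‖ :=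
  (LinearMap.toContinuousLinearMap (Matrix.toEuclideanLin A)).le_opNorm v

lemma norm_le_of_norm_mv_le (A : Mat d) {M : ℝ} (hM : 0 ≤ M)
    (h : ∀ v, ‖mv A v‖ ≤ M * ‖v‖) : ‖A‖ ≤ M :=
  (LinearMap.toContinuousLinearMap (Matrix.toEuclideanLin A)).opNorm_le_bound hM h

lemma inner_mv (A : Mat d) (v w : EV d) : ⟪v, mv A w⟫ = v.ofLp ⬝ᵥ A *ᵥ w.ofLp :=
  Matrix.inner_toEuclideanCLM A v w

lemma inner_mv_comm {A : Mat d} (hA : A.IsSymm) (v w : EV d) : ⟪v, mv A w⟫ = ⟪w, mv A v⟫ := by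
  rw [inner_mv, inner_mv, Matrix.dotProduct_mulVec, ← Matrix.mulVec_transpose, hA.eq,
    dotProduct_comm]

lemma posSemidef_inner_mv_nonneg {A : Mat d} (hA : A.PosSemidef) (v : EV d) : 0 ≤ ⟪v, mv A v⟫ := by
  rw [inner_mv]
  simpa using hA.dotProduct_mulVec_nonneg v.ofLp

lemma inner_mv_ge_of_posSemidef_sub {A : Mat d} {a : ℝ} (h : (A - a • (1 : Mat d)).PosSemidef)
    (v : EV d) : a * ‖v‖ ^ 2 ≤ ⟪v, mv A v⟫ := by
  have := posSemidef_inner_mv_nonneg h v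
  rw [sub_mv, smul_one_mv, inner_sub_right, real_inner_smul_right, real_inner_self_eq_norm_sq]
    at this
  linarith

lemma inner_mv_le_of_posSemidef_sub {A : Mat d} {a : ℝ} (h : (a • (1 : Mat d) - A).PosSemidef)
    (v : EV d) : ⟪v, mv A v⟫ ≤ a * ‖v‖ ^ 2 := by
  have := posSemidef_inner_mv_nonneg h v
  rw [sub_mv, smul_one_mv, inner_sub_right, real_inner_smul_right, real_inner_self_eq_norm_sq]
    at this
  linarith

lemma norm_mv_ge_of_coercive {A : Mat d} {a : ℝ} (h : ∀ v : EV d, a * ‖v‖ ^ 2 ≤ ⟪v, mv A v⟫)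
    (v : EV d) : a * ‖v‖ ≤ ‖mv A v‖ := by
  have h1 := (h v).trans (real_inner_le_norm v (mv A v))
  rcases (norm_nonneg v).eq_or_lt with h0 | h0
  · rw [← h0]; simp
  · refine le_of_mul_le_mul_left ?_ h0
    nlinarith

/-- A coercive matrix is invertible and its inverse is bounded by the coercivity constant. -/
lemma isUnit_of_coercive {A : Mat d} {a : ℝ} (ha : 0 < a)
    (h : ∀ v : EV d, a * ‖v‖ ^ 2 ≤ ⟪v, mv A v⟫) : IsUnit A := by
  rw [← Matrix.mulVec_injective_iff_isUnit]
  intro x y hxy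
  have h1 := norm_mv_ge_of_coercive h (WithLp.toLp 2 (x - y))
  have h2 : mv A (WithLp.toLp 2 (x - y)) = 0 := by
    simp [mv, Matrix.toLpLin_apply, Matrix.mulVec_sub, hxy]
  rw [h2, norm_zero] at h1
  have h3 : WithLp.toLp 2 (x - y) = (0 : EV d) :=
    norm_le_zero_iff.1 (nonpos_of_mul_nonpos_right h1 ha)
  simpa [sub_eq_zero] using h3

lemma norm_inv_le_of_coercive {A : Mat d} {a : ℝ} (ha : 0 < a)
    (h : ∀ v : EV d, a * ‖v‖ ^ 2 ≤ ⟪v, mv A v⟫) : ‖A⁻¹‖ ≤ a⁻¹ := by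
  refine norm_le_of_norm_mv_le _ (by positivity) fun v => ?_
  have h1 := norm_mv_ge_of_coercive h (mv A⁻¹ v)
  rw [← mv_mul, Matrix.mul_nonsing_inv _ ((Matrix.isUnit_iff_isUnit_det A).1
    (isUnit_of_coercive ha h)), mv_one] at h1
  rw [inv_mul_eq_div, le_div_iff₀ ha]
  linarith

lemma norm_le_of_inner_mv_le {A : Mat d} {a : ℝ} (hA : A.IsSymm) (ha : 0 ≤ a)
    (h0 : ∀ v : EV d, 0 ≤ ⟪v, mv A v⟫)
    (h : ∀ v : EV d, ⟪v, mv A v⟫ ≤ a * ‖v‖ ^ 2) : ‖A‖ ≤ a := by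
  refine norm_le_of_norm_mv_le _ ha fun v => ?_
  have key : ∀ u : EV d, 4 * ⟪u, mv A v⟫ ≤ a * (‖u‖ + ‖v‖) ^ 2 := fun u => by
    have e1 := h (u + v)
    have e2 := h0 (u - v)
    have e3 : ‖u + v‖ ^ 2 ≤ (‖u‖ + ‖v‖) ^ 2 :=
      pow_le_pow_left₀ (norm_nonneg _) (norm_add_le u v) 2
    have e4 := mul_le_mul_of_nonneg_left e3 ha
    rw [mv_add, inner_add_left, inner_add_right, inner_add_right] at e1
    rw [mv_sub, inner_sub_left, inner_sub_right, inner_sub_right] at e2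
    have := inner_mv_comm hA u v
    linarith
  rcases (norm_nonneg (mv A v)).eq_or_lt with hz | hz
  · rw [← hz]; positivity
  rcases (norm_nonneg v).eq_or_lt with hv | hv
  · have : v = 0 := norm_eq_zero.1 hv.symm
    simp [this, mv]
  have := key ((‖v‖ / ‖mv A v‖) • mv A v)
  rw [real_inner_smul_left, real_inner_self_eq_norm_sq, norm_smul, norm_div, norm_norm, norm_norm,
    div_mul_cancel₀ _ hz.ne'] at this
  have e : ‖v‖ / ‖mv A v‖ * ‖mv A v‖ ^ 2 = ‖v‖ * ‖mv A v‖ := by field_simp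
  rw [e] at this
  refine le_of_mul_le_mul_left ?_ hv
  nlinarith

/-- An orthogonal projection matrix has spectral norm at most one. -/
lemma norm_le_one_of_isProj {Q : Mat d} (hs : Qᵀ = Q) (hq : Q * Q = Q) : ‖Q‖ ≤ 1 := by
  have h := Matrix.l2_opNorm_conjTranspose_mul_self Q
  rw [Matrix.conjTranspose_eq_transpose_of_trivial, hs, hq] at h
  by_contra hlt
  push Not at hlt
  nlinarith

lemma norm_one_le_one : ‖(1 : Mat d)‖ ≤ 1 := norm_le_one_of_isProj (by simp) (by simp)

section Sketch

variable {q : ℕ} {pinvq : Matrix (Fin q) (Fin q) ℝ → Matrix (Fin q) (Fin q) ℝ}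
  (hp : ∀ A, IsMoorePenrose A (pinvq A)) {B : Mat d} (hB : Bᵀ = B) (s : SkMat d q)

include hp hB

lemma skProj_mul_self_mul : skProj pinvq B s * (B * s) = B * s := by
  have hG : (B * s)ᵀ * (B * s) = sᵀ * (B * B) * s := by
    rw [Matrix.transpose_mul, hB]; simp only [Matrix.mul_assoc]
  have h1 := (hp (sᵀ * (B * B) * s)).1
  rw [← hG] at h1
  have e : skProj pinvq B s * (B * s)
      = (B * s) * (pinvq ((B * s)ᵀ * (B * s)) * ((B * s)ᵀ * (B * s))) := by
    rw [skProj, ← hG, Matrix.transpose_mul, hB]; simp only [Matrix.mul_assoc]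
  rw [e]
  set A := B * s
  set N := pinvq (Aᵀ * A)
  rw [← sub_eq_zero, ← Matrix.conjTranspose_mul_self_eq_zero,
    Matrix.conjTranspose_eq_transpose_of_trivial]
  have e2 : A * (N * (Aᵀ * A)) - A = A * (N * (Aᵀ * A) - 1) := by
    rw [Matrix.mul_sub, Matrix.mul_one]
  have e3 : Aᵀ * (A * (N * (Aᵀ * A) - 1)) = 0 := by
    rw [← Matrix.mul_assoc, Matrix.mul_sub, Matrix.mul_one, ← Matrix.mul_assoc, h1, sub_self]
  rw [e2]
  nth_rw 1 [Matrix.transpose_mul]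
  rw [Matrix.mul_assoc, e3, Matrix.mul_zero]

lemma skProj_transpose : (skProj pinvq B s)ᵀ = skProj pinvq B s := by
  have h := skProj_mul_self_mul hp hB s
  set P := skProj pinvq B s with hP
  have e : P = (B * s) * pinvq (sᵀ * (B * B) * s) * (B * s)ᵀ := by
    rw [hP, skProj, Matrix.transpose_mul, hB]; simp only [Matrix.mul_assoc]
  have e2 : Pᵀ = P * Pᵀ := by
    nth_rw 1 [e]
    nth_rw 2 [e]
    rw [Matrix.transpose_mul, Matrix.transpose_transpose, Matrix.transpose_mul,
      ← Matrix.mul_assoc P, h]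
  calc Pᵀ = P * Pᵀ := e2
    _ = (P * Pᵀ)ᵀ := by rw [Matrix.transpose_mul, Matrix.transpose_transpose]
    _ = P := by rw [← e2, Matrix.transpose_transpose]

lemma skProj_mul_self : skProj pinvq B s * skProj pinvq B s = skProj pinvq B s := by
  have h := skProj_mul_self_mul hp hB s
  have e : skProj pinvq B s = (B * s) * (pinvq (sᵀ * (B * B) * s) * sᵀ * B) := by
    rw [skProj]; simp only [Matrix.mul_assoc]
  nth_rw 2 [e]
  rw [← Matrix.mul_assoc, h, ← e]

lemma norm_skProj_le : ‖skProj pinvq B s‖ ≤ 1 :=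
  norm_le_one_of_isProj (skProj_transpose hp hB s) (skProj_mul_self hp hB s)

lemma norm_one_sub_skProj_le : ‖1 - skProj pinvq B s‖ ≤ 1 := by
  refine norm_le_one_of_isProj ?_ ?_
  · rw [Matrix.transpose_sub, Matrix.transpose_one, skProj_transpose hp hB s]
  · rw [Matrix.mul_sub, Matrix.sub_mul, Matrix.sub_mul, skProj_mul_self hp hB s]; simp

/-- The range of the sketch projection at `B'` is nearly fixed by the one at `B`. -/
lemma norm_one_sub_skProj_mul_skProj_le {B' : Mat d} (hB' : B'ᵀ = B') (hu : IsUnit B') :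
    ‖(1 - skProj pinvq B s) * skProj pinvq B' s‖ ≤ ‖B - B'‖ * ‖B'⁻¹‖ := by
  have hu' := (Matrix.isUnit_iff_isUnit_det B').1 hu
  set P := skProj pinvq B s with hP
  set P' := skProj pinvq B' s with hP'
  have e1 : s * (pinvq (sᵀ * (B' * B') * s) * sᵀ * B') = B'⁻¹ * P' := by
    rw [hP', skProj]
    simp only [Matrix.mul_assoc]
    rw [Matrix.nonsing_inv_mul_cancel_left _ _ hu']
  have e2 : P' = B' * (B'⁻¹ * P') := (Matrix.mul_nonsing_inv_cancel_left _ _ hu').symm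
  have e3 : (1 - P) * (B * (B'⁻¹ * P')) = 0 := by
    rw [← e1, ← Matrix.mul_assoc B, ← Matrix.mul_assoc, Matrix.sub_mul, Matrix.one_mul,
      skProj_mul_self_mul hp hB s, sub_self, Matrix.zero_mul]
  have e4 : (1 - P) * P' = (1 - P) * ((B' - B) * (B'⁻¹ * P')) := by
    rw [Matrix.sub_mul B', ← e2, Matrix.mul_sub, e3, sub_zero]
  rw [e4]
  calc ‖(1 - P) * ((B' - B) * (B'⁻¹ * P'))‖
      ≤ ‖1 - P‖ * (‖B' - B‖ * (‖B'⁻¹‖ * ‖P'‖)) :=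
        (norm_mul_le _ _).trans (mul_le_mul_of_nonneg_left ((norm_mul_le _ _).trans
          (mul_le_mul_of_nonneg_left (norm_mul_le _ _) (norm_nonneg _))) (norm_nonneg _))
    _ ≤ 1 * (‖B' - B‖ * (‖B'⁻¹‖ * 1)) := by
        gcongr
        · exact norm_one_sub_skProj_le hp hB s
        · exact norm_skProj_le hp hB' s
    _ = ‖B - B'‖ * ‖B'⁻¹‖ := by rw [norm_sub_rev]; ring

lemma norm_skProj_sub_skProj_le {B' : Mat d} (hB' : B'ᵀ = B') (hu : IsUnit B) (hu' : IsUnit B') :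
    ‖skProj pinvq B s - skProj pinvq B' s‖ ≤ ‖B - B'‖ * (‖B⁻¹‖ + ‖B'⁻¹‖) := by
  have h1 := norm_one_sub_skProj_mul_skProj_le hp hB s hB' hu'
  have h2 := norm_one_sub_skProj_mul_skProj_le hp hB' s hB hu
  rw [← Matrix.l2_opNorm_conjTranspose, Matrix.conjTranspose_eq_transpose_of_trivial,
    Matrix.transpose_mul, Matrix.transpose_sub, Matrix.transpose_one,
    skProj_transpose hp hB s, skProj_transpose hp hB' s, norm_sub_rev B' B] at h2
  have e : skProj pinvq B s - skProj pinvq B' s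
      = skProj pinvq B s * (1 - skProj pinvq B' s)
        - (1 - skProj pinvq B s) * skProj pinvq B' s := by
    rw [Matrix.mul_sub, Matrix.sub_mul]; simp
  rw [e]
  exact (norm_sub_le _ _).trans (by linarith)

end Sketch

lemma norm_list_prod_le_one (l : List (Mat d)) (h : ∀ A ∈ l, ‖A‖ ≤ 1) : ‖l.prod‖ ≤ 1 := by
  induction l with
  | nil => simpa using norm_one_le_one
  | cons A l ih =>
    rw [List.prod_cons]
    exact (norm_mul_le _ _).trans (mul_le_one₀ (h A (by simp)) (norm_nonneg _)
      (ih fun C hC => h C (by simp [hC])))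

/-- Reversed products of contractions depend on their factors in a Lipschitz way. -/
lemma norm_ofFn_reverse_prod_sub_le {n : ℕ} (f g : Fin n → Mat d) (hf : ∀ i, ‖f i‖ ≤ 1)
    (hg : ∀ i, ‖g i‖ ≤ 1) {δ : ℝ} (h : ∀ i, ‖f i - g i‖ ≤ δ) :
    ‖(List.ofFn f).reverse.prod - (List.ofFn g).reverse.prod‖ ≤ n * δ := by
  induction n with
  | zero => simp
  | succ n ih =>
    rw [List.ofFn_succ, List.ofFn_succ, List.reverse_cons, List.reverse_cons, List.prod_append,
      List.prod_append, List.prod_singleton, List.prod_singleton]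
    have ih' := ih (fun i => f i.succ) (fun i => g i.succ) (fun i => hf _) (fun i => hg _)
      (fun i => h _)
    set X := (List.ofFn fun i => f i.succ).reverse.prod
    set Y := (List.ofFn fun i => g i.succ).reverse.prod with hY
    have hYn : ‖Y‖ ≤ 1 := by
      refine norm_list_prod_le_one _ fun A hA => ?_
      rw [List.mem_reverse, List.mem_ofFn] at hA
      obtain ⟨i, rfl⟩ := hA
      exact hg _
    have e : X * f 0 - Y * g 0 = (X - Y) * f 0 + Y * (f 0 - g 0) := by
      rw [Matrix.sub_mul, Matrix.mul_sub]; abel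
    rw [e]
    have h1 : ‖(X - Y) * f 0‖ ≤ n * δ :=
      (norm_mul_le _ _).trans ((mul_le_mul ih' (hf 0) (norm_nonneg _)
        ((norm_nonneg _).trans ih')).trans_eq (mul_one _))
    have h2 : ‖Y * (f 0 - g 0)‖ ≤ δ :=
      (norm_mul_le _ _).trans ((mul_le_mul hYn (h 0) (norm_nonneg _) zero_le_one).trans_eq
        (one_mul _))
    refine (norm_add_le _ _).trans ?_
    push_cast
    linarith

end LinearAlgebra

namespace SNSetting

section Pointwise

open scoped Matrix.Norms.L2Operator

variable {d q τ : ℕ} {Ω : Type*} [mΩ : MeasurableSpace Ω] {μ : Measure Ω}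
  {Ξs : Type*} [MeasurableSpace Ξs] (st : SNSetting d q τ Ω μ Ξs)

lemma Bstar_transpose : st.Bstarᵀ = st.Bstar := by
  let D : EV d →ₗ[ℝ] StrongDual ℝ (EV d) :=
    { toFun := fun v => InnerProductSpace.toDual ℝ (EV d) v
      map_add' := fun v w => map_add _ v w
      map_smul' := fun a v => by simp }
  have h2 : HasFDerivAt (fun y => InnerProductSpace.toDual ℝ (EV d) (st.gradF y))
      ((LinearMap.toContinuousLinearMap D).comp
        (LinearMap.toContinuousLinearMap (Matrix.toEuclideanLin (st.HessF st.xstar)))) st.xstar :=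
    (LinearMap.toContinuousLinearMap D).hasFDerivAt.comp st.xstar (st.hHessF st.xstar)
  have hs := second_derivative_symmetric (fun y => (st.hgradF y).hasFDerivAt) h2
  have key : ∀ v w : EV d, ⟪mv st.Bstar v, w⟫ = ⟪mv st.Bstar w, v⟫ := fun v w => by
    simpa [mv, Bstar, D] using hs v w
  ext i j
  have := key (EuclideanSpace.single i 1) (EuclideanSpace.single j 1)
  simpa [mv, Matrix.toLpLin_apply, EuclideanSpace.inner_single_right] using this

lemma gradF_xstar : st.gradF st.xstar = 0 := by
  have hmin : IsLocalMin st.F st.xstar := by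
    refine Filter.Eventually.of_forall fun y => ?_
    rcases eq_or_ne y st.xstar with rfl | h
    · exact le_rfl
    · exact (st.hxstar y h).le
  have := hmin.hasFDerivAt_eq_zero (st.hgradF st.xstar).hasFDerivAt
  simpa using this

lemma norm_Hessf_le (x : EV d) (ξv : Ξs) : ‖st.Hessf x ξv‖ ≤ st.ΥH := by
  refine norm_le_of_inner_mv_le (st.hA3sym x ξv) (st.hγH.le.trans st.hγΥ) (fun v => ?_)
    (inner_mv_le_of_posSemidef_sub (st.hA3a x ξv).2)
  exact (mul_nonneg st.hγH.le (sq_nonneg _)).trans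
    (inner_mv_ge_of_posSemidef_sub (st.hA3a x ξv).1 v)

lemma norm_gradf_sub_le (x y : EV d) (ξv : Ξs) :
    ‖st.gradf x ξv - st.gradf y ξv‖ ≤ st.ΥH * ‖x - y‖ :=
  convex_univ.norm_image_sub_le_of_norm_hasFDerivWithin_le
    (fun z _ => (st.hHessf ξv z).hasFDerivWithinAt) (fun z _ => st.norm_Hessf_le z ξv)
    (Set.mem_univ y) (Set.mem_univ x)

lemma B_coercive (t : ℕ) (ω : Ω) (v : EV d) :
    min st.γH 1 * ‖v‖ ^ 2 ≤ ⟪v, mv (st.B t ω) v⟫ := by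
  rcases Nat.eq_zero_or_pos t with rfl | ht
  · rw [st.hB0, mv_one, real_inner_self_eq_norm_sq]
    exact mul_le_of_le_one_left (sq_nonneg _) (min_le_right _ _)
  · have ht' : (0 : ℝ) < t := by exact_mod_cast ht
    rw [st.hBt t ω ht, smul_sum_mv, real_inner_smul_right, inner_sum]
    calc min st.γH 1 * ‖v‖ ^ 2 ≤ st.γH * ‖v‖ ^ 2 := by gcongr; exact min_le_left _ _
      _ = (t : ℝ)⁻¹ * ∑ _i ∈ Finset.range t, st.γH * ‖v‖ ^ 2 := by
        rw [Finset.sum_const, Finset.card_range, nsmul_eq_mul, inv_mul_cancel_left₀ ht'.ne']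
      _ ≤ _ := by
        gcongr with i
        exact inner_mv_ge_of_posSemidef_sub (st.hA3a _ _).1 v

lemma B_transpose (t : ℕ) (ω : Ω) : (st.B t ω)ᵀ = st.B t ω := by
  rcases Nat.eq_zero_or_pos t with rfl | ht
  · rw [st.hB0, Matrix.transpose_one]
  · rw [st.hBt t ω ht, Matrix.transpose_smul, Matrix.transpose_sum]
    simp only [(st.hA3sym _ _).eq]

lemma isUnit_B (t : ℕ) (ω : Ω) : IsUnit (st.B t ω) :=
  isUnit_of_coercive (lt_min st.hγH one_pos) (st.B_coercive t ω)

lemma norm_B_inv_le (t : ℕ) (ω : Ω) : ‖(st.B t ω)⁻¹‖ ≤ (min st.γH 1)⁻¹ :=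
  norm_inv_le_of_coercive (lt_min st.hγH one_pos) (st.B_coercive t ω)

lemma Δ_eq (t j : ℕ) (ω : Ω) :
    st.Δ t j ω = -(mv ((1 - ((List.ofFn fun i : Fin j =>
      (1 : Mat d) - skProj st.pinvq (st.B t ω) (st.S t i ω)).reverse).prod) * (st.B t ω)⁻¹)
        (st.gradf (st.x t ω) (st.ξ t ω))) := by
  have hdet := (Matrix.isUnit_iff_isUnit_det _).1 (st.isUnit_B t ω)
  induction j with
  | zero => simp [st.hΔ0, mv]
  | succ j ih =>
    rw [List.ofFn_succ', List.concat_eq_append, List.reverse_append, List.reverse_singleton,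
      List.singleton_append, List.prod_cons]
    simp only [Fin.val_castSucc, Fin.val_last]
    set C := ((List.ofFn fun i : Fin j =>
      (1 : Mat d) - skProj st.pinvq (st.B t ω) (st.S t i ω)).reverse).prod
    set P := skProj st.pinvq (st.B t ω) (st.S t j ω) with hP
    set g := st.gradf (st.x t ω) (st.ξ t ω)
    have hg : g = mv (st.B t ω) (mv (st.B t ω)⁻¹ g) := by
      rw [← mv_mul, Matrix.mul_nonsing_inv _ hdet, mv_one]
    rw [st.hΔrec]
    change st.Δ t j ω - mv _ (mv (st.B t ω) (st.Δ t j ω) + g) = _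
    nth_rw 1 [hg]
    rw [← mv_add, ← mv_mul]
    change st.Δ t j ω - mv P (st.Δ t j ω + mv (st.B t ω)⁻¹ g) = _
    rw [ih]
    simp only [mv_mul, sub_mv, mv_add, mv_sub, mv_neg, mv_one]
    abel

lemma Δbar_eq (t : ℕ) (ω : Ω) :
    st.Δbar t ω = -(mv ((1 - st.Ctil t ω) * (st.B t ω)⁻¹) (st.gradf (st.x t ω) (st.ξ t ω))) :=
  st.Δ_eq t τ ω

lemma norm_one_sub_Ctil_le (t : ℕ) (ω : Ω) : ‖1 - st.Ctil t ω‖ ≤ 2 := by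
  refine (norm_sub_le _ _).trans ?_
  have h1 : ‖(1 : Mat d)‖ ≤ 1 := norm_one_le_one
  have h2 : ‖st.Ctil t ω‖ ≤ 1 := by
    refine norm_list_prod_le_one _ fun A hA => ?_
    rw [List.mem_reverse, List.mem_ofFn] at hA
    obtain ⟨i, rfl⟩ := hA
    exact norm_one_sub_skProj_le st.hpinvq (st.B_transpose t ω) _
  linarith

lemma norm_one_sub_CtilStar_le (t : ℕ) (ω : Ω) : ‖1 - st.CtilStar t ω‖ ≤ 2 := by
  refine (norm_sub_le _ _).trans ?_
  have h1 : ‖(1 : Mat d)‖ ≤ 1 := norm_one_le_one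
  have h2 : ‖st.CtilStar t ω‖ ≤ 1 := by
    refine norm_list_prod_le_one _ fun A hA => ?_
    rw [List.mem_reverse, List.mem_ofFn] at hA
    obtain ⟨i, rfl⟩ := hA
    exact norm_one_sub_skProj_le st.hpinvq st.Bstar_transpose _
  linarith

lemma norm_Ctil_sub_CtilStar_le (hu : IsUnit st.Bstar) (t : ℕ) (ω : Ω) :
    ‖st.Ctil t ω - st.CtilStar t ω‖
      ≤ τ * (‖st.B t ω - st.Bstar‖ * (‖(st.B t ω)⁻¹‖ + ‖st.Bstar⁻¹‖)) := by
  refine norm_ofFn_reverse_prod_sub_le _ _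
    (fun i => norm_one_sub_skProj_le st.hpinvq (st.B_transpose t ω) _)
    (fun i => norm_one_sub_skProj_le st.hpinvq st.Bstar_transpose _) fun i => ?_
  rw [sub_sub_sub_cancel_left, norm_sub_rev]
  exact norm_skProj_sub_skProj_le st.hpinvq (st.B_transpose t ω) _ st.Bstar_transpose
    (st.isUnit_B t ω) hu

lemma norm_gradf_le (k : ℕ) (ω : Ω) : ‖st.gradf (st.x k ω) (st.ξ k ω)‖ ≤
    st.ΥH * ‖st.x k ω - st.xstar‖ + ‖st.gradf st.xstar (st.ξ k ω)‖ := by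
  have := norm_le_norm_add_norm_sub' (st.gradf (st.x k ω) (st.ξ k ω))
    (st.gradf st.xstar (st.ξ k ω))
  linarith [st.norm_gradf_sub_le (st.x k ω) st.xstar (st.ξ k ω)]

/-- A singular `B*` stays at a definite distance from every averaged Hessian. -/
lemma one_le_of_not_isUnit_Bstar (hu : ¬ IsUnit st.Bstar) (k : ℕ) (ω : Ω) :
    1 ≤ (min st.γH 1)⁻¹ * ‖st.B k ω - st.Bstar‖ := by
  by_contra hlt
  push Not at hlt
  have h1 : ‖(st.B k ω)⁻¹ * (st.B k ω - st.Bstar)‖ < 1 :=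
    ((norm_mul_le _ _).trans (mul_le_mul_of_nonneg_right (st.norm_B_inv_le k ω)
      (norm_nonneg _))).trans_lt hlt
  have h2 := isUnit_one_sub_of_norm_lt_one h1
  have hdet := (Matrix.isUnit_iff_isUnit_det _).1 (st.isUnit_B k ω)
  rw [Matrix.mul_sub, Matrix.nonsing_inv_mul _ hdet, sub_sub_cancel] at h2
  refine hu ?_
  have h3 := (st.isUnit_B k ω).mul h2
  rwa [Matrix.mul_nonsing_inv_cancel_left _ _ hdet] at h3

/-- Pathwise comparison of the sketched Newton direction with its approximation at `x*`. -/
lemma exists_norm_Δbar_sub_θtil_le : ∃ K : ℝ, 0 ≤ K ∧ ∀ k ω,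
    ‖st.Δbar k ω - st.θtil k ω‖ ≤ K * (‖st.x k ω - st.xstar‖ +
      ‖st.gradf st.xstar (st.ξ k ω)‖ * specNorm (st.B k ω - st.Bstar)) := by
  set b := (min st.γH 1)⁻¹ with hb
  have hb0 : 0 ≤ b := inv_nonneg.2 (le_min st.hγH.le zero_le_one)
  have hΥ : 0 ≤ st.ΥH := st.hγH.le.trans st.hγΥ
  set b' := ‖st.Bstar⁻¹‖ with hb'
  have hb'0 : 0 ≤ b' := norm_nonneg _
  refine ⟨2 * b * st.ΥH + 2 * b * b + 2 * b * b' + τ * (b + b') * b', by positivity,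
    fun k ω => ?_⟩
  rw [specNorm_eq_norm]
  set r := ‖st.x k ω - st.xstar‖
  set g' := st.gradf st.xstar (st.ξ k ω)
  set e := ‖st.B k ω - st.Bstar‖
  have hr : 0 ≤ r := norm_nonneg _
  have he : 0 ≤ e := norm_nonneg _
  have hg'0 : 0 ≤ ‖g'‖ := norm_nonneg _
  have hB := st.norm_B_inv_le k ω
  have hC := st.norm_one_sub_Ctil_le k ω
  have hM : ‖(1 - st.Ctil k ω) * (st.B k ω)⁻¹‖ ≤ 2 * b :=
    (norm_mul_le _ _).trans (mul_le_mul hC hB (norm_nonneg _) zero_le_two)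
  have hX : 0 ≤ τ * (b + b') * b' := by positivity
  by_cases hu : IsUnit st.Bstar
  · have hdet := (Matrix.isUnit_iff_isUnit_det _).1 (st.isUnit_B k ω)
    have hdet' := (Matrix.isUnit_iff_isUnit_det _).1 hu
    have hsplit : st.Δbar k ω - st.θtil k ω =
        -(mv ((1 - st.Ctil k ω) * (st.B k ω)⁻¹) (st.gradf (st.x k ω) (st.ξ k ω) - g')
          + mv (((1 - st.Ctil k ω) * (st.B k ω)⁻¹) * ((st.Bstar - st.B k ω) * st.Bstar⁻¹)) g'
          - mv ((st.Ctil k ω - st.CtilStar k ω) * st.Bstar⁻¹) g') := by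
      have e1 : ((1 - st.Ctil k ω) * (st.B k ω)⁻¹) * ((st.Bstar - st.B k ω) * st.Bstar⁻¹)
          = (1 - st.Ctil k ω) * (st.B k ω)⁻¹ - (1 - st.Ctil k ω) * st.Bstar⁻¹ := by
        rw [Matrix.sub_mul st.Bstar, Matrix.mul_nonsing_inv _ hdet', Matrix.mul_sub,
          Matrix.mul_one, Matrix.mul_assoc _ (st.B k ω)⁻¹, Matrix.nonsing_inv_mul_cancel_left _ _ hdet]
      rw [e1, st.Δbar_eq, θtil]
      simp only [mv_sub, sub_mv, Matrix.sub_mul]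
      abel
    have h1 : ‖mv ((1 - st.Ctil k ω) * (st.B k ω)⁻¹) (st.gradf (st.x k ω) (st.ξ k ω) - g')‖
        ≤ 2 * b * (st.ΥH * r) :=
      (norm_mv_le _ _).trans (mul_le_mul hM (st.norm_gradf_sub_le _ _ _) (norm_nonneg _)
        (by positivity))
    have h2 : ‖mv (((1 - st.Ctil k ω) * (st.B k ω)⁻¹) * ((st.Bstar - st.B k ω) * st.Bstar⁻¹)) g'‖
        ≤ (2 * b) * (e * b') * ‖g'‖ := by
      refine (norm_mv_le _ _).trans (mul_le_mul_of_nonneg_right ?_ hg'0)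
      refine (norm_mul_le _ _).trans (mul_le_mul hM ?_ (norm_nonneg _) (by positivity))
      exact (norm_mul_le _ _).trans_eq (by rw [norm_sub_rev])
    have h3 : ‖mv ((st.Ctil k ω - st.CtilStar k ω) * st.Bstar⁻¹) g'‖
        ≤ (τ * (e * (b + b'))) * b' * ‖g'‖ := by
      refine (norm_mv_le _ _).trans (mul_le_mul_of_nonneg_right ?_ hg'0)
      refine (norm_mul_le _ _).trans (mul_le_mul_of_nonneg_right ?_ hb'0)
      exact (st.norm_Ctil_sub_CtilStar_le hu k ω).trans (by gcongr)
    rw [hsplit, norm_neg]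
    refine (norm_sub_le _ _).trans ((add_le_add_left (norm_add_le _ _) _).trans ?_)
    have p1 : 0 ≤ (2 * b * b + 2 * b * b' + τ * (b + b') * b') * r := by positivity
    have p2 : 0 ≤ (2 * b * st.ΥH + 2 * b * b) * (‖g'‖ * e) := by positivity
    nlinarith
  · have hθ : st.θtil k ω = 0 := by
      rw [θtil, Matrix.nonsing_inv_apply_not_isUnit _
        (fun h => hu ((Matrix.isUnit_iff_isUnit_det _).2 h))]
      simp [mv]
    have h1 := st.one_le_of_not_isUnit_Bstar hu k ω
    have h2 : ‖st.Δbar k ω‖ ≤ 2 * b * (st.ΥH * r + ‖g'‖) := by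
      rw [st.Δbar_eq, norm_neg]
      exact (norm_mv_le _ _).trans (mul_le_mul hM (st.norm_gradf_le k ω) (norm_nonneg _)
        (by positivity))
    have h3 : ‖g'‖ ≤ b * (‖g'‖ * e) := by
      calc ‖g'‖ = ‖g'‖ * 1 := (mul_one _).symm
        _ ≤ ‖g'‖ * (b * e) := mul_le_mul_of_nonneg_left h1 hg'0
        _ = _ := by ring
    have h4 := mul_le_mul_of_nonneg_left h3 (by positivity : 0 ≤ 2 * b)
    rw [hθ, sub_zero]
    have p1 : 0 ≤ (2 * b * b + 2 * b * b' + τ * (b + b') * b') * r := by positivity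
    have p2 : 0 ≤ (2 * b * st.ΥH + 2 * b * b' + τ * (b + b') * b') * (‖g'‖ * e) := by positivity
    nlinarith

end Pointwise

end SNSetting

section MeasurableMatrix

variable {m n l : ℕ} {α : Type*} {mα : MeasurableSpace α}

lemma borelSpace_matrix : BorelSpace (Matrix (Fin m) (Fin n) ℝ) :=
  inferInstanceAs (BorelSpace (Fin m → Fin n → ℝ))

lemma measurable_matrix_iff {A : α → Matrix (Fin m) (Fin n) ℝ} :
    Measurable A ↔ ∀ i j, Measurable fun a => A a i j :=
  measurable_pi_iff.trans (forall_congr' fun _ => measurable_pi_iff)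

lemma Measurable.matrix_entry {A : α → Matrix (Fin m) (Fin n) ℝ} (hA : Measurable A) (i j) :
    Measurable fun a => A a i j :=
  measurable_matrix_iff.1 hA i j

lemma Measurable.matrix_mul {A : α → Matrix (Fin m) (Fin n) ℝ}
    {B : α → Matrix (Fin n) (Fin l) ℝ} (hA : Measurable A) (hB : Measurable B) :
    Measurable fun a => A a * B a := by
  refine measurable_matrix_iff.2 fun i j => ?_
  simp only [Matrix.mul_apply]
  exact Finset.measurable_sum _ fun k _ => (hA.matrix_entry i k).mul (hB.matrix_entry k j)

lemma Measurable.matrix_transpose {A : α → Matrix (Fin m) (Fin n) ℝ} (hA : Measurable A) :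
    Measurable fun a => (A a)ᵀ :=
  measurable_matrix_iff.2 fun i j => hA.matrix_entry j i

lemma Measurable.matrix_inv {A : α → Matrix (Fin n) (Fin n) ℝ} (hA : Measurable A) :
    Measurable fun a => (A a)⁻¹ := by
  have : BorelSpace (Matrix (Fin n) (Fin n) ℝ) := borelSpace_matrix
  refine measurable_matrix_iff.2 fun i j => ?_
  simp only [Matrix.inv_def, Matrix.smul_apply, smul_eq_mul, Ring.inverse_eq_inv']
  have h1 : Measurable fun A : Matrix (Fin n) (Fin n) ℝ => A.det :=
    (continuous_id.matrix_det).measurable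
  have h2 : Measurable fun A : Matrix (Fin n) (Fin n) ℝ => A.adjugate i j :=
    (continuous_id.matrix_adjugate.matrix_elem i j).measurable
  exact (h1.comp hA).inv.mul (h2.comp hA)

open scoped Matrix.Norms.L2Operator in
/-- Tikhonov regularization converges to the Moore–Penrose pseudoinverse. -/
lemma IsMoorePenrose.tendsto_regularized {A N : Matrix (Fin n) (Fin n) ℝ}
    (h : IsMoorePenrose A N) :
    Tendsto (fun k : ℕ => (Aᵀ * A + ((k : ℝ) + 1)⁻¹ • (1 : Mat n))⁻¹ * Aᵀ) atTop (nhds N) := by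
  obtain ⟨h1, h2, h3, h4⟩ := h
  have hAt : Aᵀ = Aᵀ * A * N := by
    rw [Matrix.mul_assoc]
    nth_rw 1 [← h1]
    rw [Matrix.transpose_mul, h3]
  set M := Aᵀ * A with hM
  have hN : N = M * (N * (Nᵀ * N)) := by
    calc N = (N * A)ᵀ * N := by rw [h4, h2]
      _ = Aᵀ * Nᵀ * N := by rw [Matrix.transpose_mul]
      _ = M * N * Nᵀ * N := by rw [← hAt]
      _ = _ := by simp only [Matrix.mul_assoc]
  set K := N * (Nᵀ * N)
  rw [tendsto_iff_norm_sub_tendsto_zero]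
  refine squeeze_zero (g := fun k : ℕ => ((k : ℝ) + 1)⁻¹ * (2 * ‖K‖)) (fun _ => norm_nonneg _)
    (fun k => ?_) ?_
  · have hε : 0 < ((k : ℝ) + 1)⁻¹ := by positivity
    set ε := ((k : ℝ) + 1)⁻¹
    have hco : ∀ v : EV n, ε * ‖v‖ ^ 2 ≤ ⟪v, mv (M + ε • (1 : Mat n)) v⟫ := fun v => by
      refine inner_mv_ge_of_posSemidef_sub ?_ v
      rw [add_sub_cancel_right, hM, ← Matrix.conjTranspose_eq_transpose_of_trivial]
      exact Matrix.posSemidef_conjTranspose_mul_self A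
    have hdet := (Matrix.isUnit_iff_isUnit_det _).1 (isUnit_of_coercive hε hco)
    have hinv := norm_inv_le_of_coercive hε hco
    set R := (M + ε • (1 : Mat n))⁻¹ with hR
    have hRM : R * M = 1 - ε • R := by
      have : R * (M + ε • (1 : Mat n)) = 1 := Matrix.nonsing_inv_mul _ hdet
      rw [Matrix.mul_add, Matrix.mul_smul, Matrix.mul_one] at this
      exact eq_sub_of_add_eq this
    have e : R * Aᵀ - N = -(ε • ((R * M) * K)) := by
      rw [hAt, ← Matrix.mul_assoc, hRM, Matrix.sub_mul, Matrix.one_mul, sub_sub_cancel_left,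
        ← hRM, Matrix.mul_assoc, ← hN, Matrix.smul_mul]
    have hRM' : ‖R * M‖ ≤ 2 := by
      rw [hRM]
      refine (norm_sub_le _ _).trans ?_
      have h5 : ‖ε • R‖ ≤ 1 := by
        rw [norm_smul, Real.norm_of_nonneg hε.le]
        exact (mul_le_mul_of_nonneg_left hinv hε.le).trans_eq (mul_inv_cancel₀ hε.ne')
      have h6 : ‖(1 : Mat n)‖ ≤ 1 := norm_one_le_one
      linarith
    rw [e, norm_neg, norm_smul, Real.norm_of_nonneg hε.le]
    exact mul_le_mul_of_nonneg_left ((norm_mul_le _ _).trans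
      (mul_le_mul_of_nonneg_right hRM' (norm_nonneg _))) hε.le
  · have := (tendsto_one_div_add_atTop_nhds_zero_nat (𝕜 := ℝ)).mul_const (2 * ‖K‖)
    simpa using this

/-- The Moore–Penrose pseudoinverse of square matrices is Borel measurable. -/
lemma measurable_of_isMoorePenrose
    {pinv : Matrix (Fin n) (Fin n) ℝ → Matrix (Fin n) (Fin n) ℝ}
    (hp : ∀ A, IsMoorePenrose A (pinv A)) : Measurable pinv := by
  refine measurable_matrix_iff.2 fun i j => ?_
  have hid : Measurable fun A : Matrix (Fin n) (Fin n) ℝ => A := measurable_id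
  refine measurable_of_tendsto_metrizable
    (f := fun (k : ℕ) (A : Matrix (Fin n) (Fin n) ℝ) =>
      ((Aᵀ * A + ((k : ℝ) + 1)⁻¹ • (1 : Mat n))⁻¹ * Aᵀ) i j) (fun k => ?_) ?_
  · refine Measurable.matrix_entry (Measurable.matrix_mul (Measurable.matrix_inv ?_)
      hid.matrix_transpose) i j
    refine measurable_matrix_iff.2 fun a b => ?_
    exact ((hid.matrix_transpose.matrix_mul hid).matrix_entry a b).add_const _
  · refine tendsto_pi_nhds.2 fun A => ?_
    exact ((continuous_id.matrix_elem i j).tendsto (pinv A)).comp (hp A).tendsto_regularized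

lemma Measurable.skProj {d q : ℕ} {pinvq : Matrix (Fin q) (Fin q) ℝ → Matrix (Fin q) (Fin q) ℝ}
    (hp : ∀ A, IsMoorePenrose A (pinvq A)) (B : Mat d) {s : α → SkMat d q} (hs : Measurable s) :
    Measurable fun a => skProj pinvq B (s a) := by
  have hc : ∀ {k l : ℕ} (C : Matrix (Fin k) (Fin l) ℝ), Measurable fun _ : α => C :=
    fun C => measurable_const
  have hpi := (measurable_of_isMoorePenrose hp).comp
    ((hs.matrix_transpose.matrix_mul (hc (B * B))).matrix_mul hs)
  exact ((((hc B).matrix_mul hs).matrix_mul hpi).matrix_mul hs.matrix_transpose).matrix_mul (hc B)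

lemma measurable_ofFn_reverse_prod {d N : ℕ} (f : Fin N → α → Mat d) (hf : ∀ i, Measurable (f i)) :
    Measurable fun a => (List.ofFn fun i => f i a).reverse.prod := by
  induction N with
  | zero => simp
  | succ N ih =>
    simp only [List.ofFn_succ, List.reverse_cons, List.prod_append, List.prod_singleton]
    exact (ih (fun i => f i.succ) fun i => hf _).matrix_mul (hf 0)

end MeasurableMatrix

section Independence

variable {Ω : Type*} {m₁ m₂ m₃ mΩ : MeasurableSpace Ω} {μ : Measure Ω} [IsProbabilityMeasure μ]

/-- Adjoining to `m₂` information independent of `m₂ ⊔ m₁` preserves independence from `m₁`. -/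
lemma indep_sup_right_of_indep_sup (h₁ : m₁ ≤ mΩ) (h₂ : m₂ ≤ mΩ) (h₃ : m₃ ≤ mΩ)
    (h12 : Indep m₁ m₂ μ) (h3 : Indep m₃ (m₂ ⊔ m₁) μ) : Indep m₁ (m₂ ⊔ m₃) μ := by
  set p : Set (Set Ω) :=
    {s | ∃ A B, MeasurableSet[m₂] A ∧ MeasurableSet[m₃] B ∧ s = A ∩ B} with hp
  have hgen : m₂ ⊔ m₃ = MeasurableSpace.generateFrom p := by
    refine le_antisymm (sup_le (fun A hA => ?_) fun B hB => ?_)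
      (MeasurableSpace.generateFrom_le ?_)
    · exact MeasurableSpace.measurableSet_generateFrom
        ⟨A, Set.univ, hA, @MeasurableSet.univ _ m₃, by simp⟩
    · exact MeasurableSpace.measurableSet_generateFrom
        ⟨Set.univ, B, @MeasurableSet.univ _ m₂, hB, by simp⟩
    · rintro _ ⟨A, B, hA, hB, rfl⟩
      exact MeasurableSet.inter ((le_sup_left : m₂ ≤ m₂ ⊔ m₃) A hA)
        ((le_sup_right : m₃ ≤ m₂ ⊔ m₃) B hB)
  have hpi : IsPiSystem p := by
    rintro _ ⟨A, B, hA, hB, rfl⟩ _ ⟨A', B', hA', hB', rfl⟩ -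
    exact ⟨A ∩ A', B ∩ B', @MeasurableSet.inter _ m₂ _ _ hA hA',
      @MeasurableSet.inter _ m₃ _ _ hB hB', Set.inter_inter_inter_comm _ _ _ _⟩
  refine IndepSets.indep h₁ (sup_le h₂ h₃) (@MeasurableSpace.isPiSystem_measurableSet _ m₁) hpi
    (@MeasurableSpace.generateFrom_measurableSet _ m₁).symm hgen ?_
  rw [IndepSets_iff]
  rintro X _ hX ⟨A, B, hA, hB, rfl⟩
  rw [Indep_iff] at h12 h3
  have hXA : MeasurableSet[m₂ ⊔ m₁] (A ∩ X) :=
    MeasurableSet.inter ((le_sup_left : m₂ ≤ m₂ ⊔ m₁) A hA) ((le_sup_right : m₁ ≤ m₂ ⊔ m₁) X hX)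
  have e1 : X ∩ (A ∩ B) = B ∩ (A ∩ X) := by
    ext; simp only [Set.mem_inter_iff]; tauto
  rw [e1, h3 B _ hB hXA, Set.inter_comm A X, h12 X A hX hA, Set.inter_comm A B,
    h3 B A hB ((le_sup_left : m₂ ≤ m₂ ⊔ m₁) A hA)]
  ring

end Independence

namespace SNSetting

variable {d q τ : ℕ} {Ω : Type*} [mΩ : MeasurableSpace Ω] {μ : Measure Ω}
  {Ξs : Type*} [MeasurableSpace Ξs] (st : SNSetting d q τ Ω μ Ξs)

lemma aestronglyMeasurable_f {y : EV d} (hy : st.F y ≠ 0) :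
    AEStronglyMeasurable (st.f y) st.P := by
  refine (of_not_not fun h => hy ?_ : Integrable (st.f y) st.P).aestronglyMeasurable
  rw [st.hF, integral_undef h]

lemma eventually_F_ne_zero : ∀ᶠ y in nhdsWithin st.xstar {st.xstar}ᶜ, st.F y ≠ 0 := by
  by_cases h0 : st.F st.xstar = 0
  · filter_upwards [self_mem_nhdsWithin] with y hy
    exact ne_of_gt (h0 ▸ st.hxstar y hy)
  · exact nhdsWithin_le_nhds
      ((st.hgradF st.xstar).differentiableAt.continuousAt.eventually_ne h0)

/-- The coordinates of `∇f(x*;·)` are limits of central difference quotients. -/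
lemma tendsto_central_difference (ξv : Ξs) (i : Fin d) :
    Tendsto (fun t : ℝ => t⁻¹ * (st.f (st.xstar + t • EuclideanSpace.single i 1) ξv -
      st.f (st.xstar + (-t) • EuclideanSpace.single i 1) ξv)) (nhdsWithin 0 {0}ᶜ)
      (nhds (2 * st.gradf st.xstar ξv i)) := by
  set e : EV d := EuclideanSpace.single i 1 with he
  have hline : ∀ c : ℝ, HasDerivAt (fun t : ℝ => st.f (st.xstar + (c * t) • e) ξv)
      (c * st.gradf st.xstar ξv i) 0 := fun c => by
    have h1 : HasDerivAt (fun t : ℝ => st.xstar + (c * t) • e) (c • e) 0 := by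
      have := (((hasDerivAt_id (0 : ℝ)).const_mul c).smul_const e).const_add st.xstar
      simpa using this
    have h2 : HasFDerivAt (fun y => st.f y ξv) (InnerProductSpace.toDual ℝ (EV d)
        (st.gradf st.xstar ξv)) (st.xstar + (c * 0) • e) := by
      simpa using (st.hgradf ξv st.xstar).hasFDerivAt
    have h3 := h2.comp_hasDerivAt (0 : ℝ) h1
    have h4 : InnerProductSpace.toDual ℝ (EV d) (st.gradf st.xstar ξv) (c • e) =
        c * st.gradf st.xstar ξv i := by
      rw [map_smul, InnerProductSpace.toDual_apply_apply, he, EuclideanSpace.inner_single_right]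
      simp
    exact h4 ▸ h3
  have h := ((hline 1).sub (hline (-1))).tendsto_slope_zero
  convert h using 2 with t
  · simp
  · ring

lemma aemeasurable_gradf_apply (i : Fin d) :
    AEMeasurable (fun ξv => st.gradf st.xstar ξv i) st.P := by
  set e : EV d := EuclideanSpace.single i 1 with he
  have he0 : e ≠ 0 := by simp [he]
  have hmem : ∀ c : ℝ, c ≠ 0 → ∀ᶠ t : ℝ in nhdsWithin 0 {0}ᶜ,
      AEMeasurable (st.f (st.xstar + (c * t) • e)) st.P := fun c hc => by
    have ht : Tendsto (fun t : ℝ => st.xstar + (c * t) • e) (nhdsWithin 0 {0}ᶜ)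
        (nhdsWithin st.xstar {st.xstar}ᶜ) := by
      refine tendsto_nhdsWithin_iff.2 ⟨tendsto_nhdsWithin_of_tendsto_nhds ?_, ?_⟩
      · have : Continuous fun t : ℝ => st.xstar + (c * t) • e := by fun_prop
        simpa using this.tendsto 0
      · filter_upwards [self_mem_nhdsWithin] with t ht
        have ht' : t ≠ 0 := ht
        simp [hc, ht', he0]
    filter_upwards [ht.eventually st.eventually_F_ne_zero] with t h
    exact (st.aestronglyMeasurable_f h).aemeasurable
  set D : ℝ → Ξs → ℝ := fun t ξv => t⁻¹ * (st.f (st.xstar + t • e) ξv -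
      st.f (st.xstar + (-t) • e) ξv)
  have hD : ∀ᶠ t : ℝ in nhdsWithin 0 {0}ᶜ, AEMeasurable (D t) st.P := by
    filter_upwards [hmem 1 one_ne_zero, hmem (-1) (by norm_num)] with t h1 h2
    rw [one_mul] at h1
    rw [neg_one_mul] at h2
    exact (h1.sub h2).const_mul _
  classical
  have h2 : AEMeasurable (fun ξv => 2 * st.gradf st.xstar ξv i) st.P := by
    refine aemeasurable_of_tendsto_metrizable_ae (nhdsWithin (0 : ℝ) {0}ᶜ)
      (f := fun t ξv => if AEMeasurable (D t) st.P then D t ξv else 0) (fun t => ?_)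
      (ae_of_all _ fun ξv => ?_)
    · by_cases h : AEMeasurable (D t) st.P
      · simpa only [if_pos h] using h
      · simp only [if_neg h]; exact aemeasurable_const
    · refine (st.tendsto_central_difference ξv i).congr' ?_
      filter_upwards [hD] with t ht
      rw [if_pos ht]
  simpa using h2.const_mul (1 / 2)

lemma aemeasurable_gradf : AEMeasurable (st.gradf st.xstar) st.P :=
  (MeasurableEquiv.toLp 2 (Fin d → ℝ)).measurable.comp_aemeasurable
    (aemeasurable_pi_lambda _ st.aemeasurable_gradf_apply)

/-- The gradient noise at the minimizer is square integrable. -/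
lemma memLp_gradf : MemLp (st.gradf st.xstar) 2 st.P := by
  have := st.hP
  refine ⟨st.aemeasurable_gradf.aestronglyMeasurable, ?_⟩
  rw [eLpNorm_lt_top_iff_lintegral_rpow_enorm_lt_top two_ne_zero ENNReal.ofNat_ne_top]
  have h4 := st.hA2 st.xstar
  simp only [st.gradF_xstar, sub_zero] at h4
  calc ∫⁻ ξv, ‖st.gradf st.xstar ξv‖ₑ ^ (2 : ℝ≥0∞).toReal ∂st.P
      ≤ ∫⁻ ξv, (1 + ENNReal.ofReal (‖st.gradf st.xstar ξv‖ ^ 4)) ∂st.P := by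
        refine lintegral_mono fun ξv => ?_
        have : ‖st.gradf st.xstar ξv‖ₑ ^ (2 : ℝ≥0∞).toReal
            = ENNReal.ofReal (‖st.gradf st.xstar ξv‖ ^ 2) := by
          rw [← ofReal_norm, ENNReal.ofReal_pow (norm_nonneg _)]
          simp
        rw [this, ← ENNReal.ofReal_one, ← ENNReal.ofReal_add zero_le_one (by positivity)]
        refine ENNReal.ofReal_le_ofReal ?_
        nlinarith [sq_nonneg (‖st.gradf st.xstar ξv‖ ^ 2 - 1)]
    _ = 1 + ∫⁻ ξv, ENNReal.ofReal (‖st.gradf st.xstar ξv‖ ^ 4) ∂st.P := by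
        rw [lintegral_add_left measurable_const]
        simp
    _ < ⊤ := ENNReal.add_lt_top.2 ⟨ENNReal.one_lt_top, h4.trans_lt ENNReal.ofReal_lt_top⟩

lemma measurePreserving_ξ (k : ℕ) : MeasurePreserving (st.ξ k) μ st.P :=
  ⟨st.hmeasξ k, st.hdistξ k⟩

/-- The σ-algebra of the past together with the first `N` sketches of iteration `k`. -/
@[reducible] def pastSketch (k N : ℕ) : MeasurableSpace Ω :=
  st.𝔉 k ⊔ ⨆ j ∈ Finset.range N, MeasurableSpace.comap (st.S k j) inferInstance

lemma pastSketch_le (k N : ℕ) : st.pastSketch k N ≤ mΩ :=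
  sup_le (st.h𝔉le k) (iSup₂_le fun j _ => (st.hmeasS k j).comap_le)

lemma indep_ξ_pastSketch (k N : ℕ) :
    Indep (MeasurableSpace.comap (st.ξ k) inferInstance) (st.pastSketch k N) μ := by
  have := st.hμ
  induction N with
  | zero => simpa [pastSketch] using st.hindepξ k
  | succ N ih =>
    have h3 : Indep (MeasurableSpace.comap (st.S k N) inferInstance)
        (st.pastSketch k N ⊔ MeasurableSpace.comap (st.ξ k) inferInstance) μ := by
      have := st.hindepS k N
      rwa [sup_right_comm] at this
    have h := indep_sup_right_of_indep_sup (st.hmeasξ k).comap_le (st.pastSketch_le k N)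
      (st.hmeasS k N).comap_le ih h3
    have e : st.pastSketch k (N + 1) =
        st.pastSketch k N ⊔ MeasurableSpace.comap (st.S k N) inferInstance := by
      rw [pastSketch, Finset.range_add_one, Finset.iSup_insert, pastSketch, sup_assoc,
        sup_comm (MeasurableSpace.comap (st.S k N) inferInstance)]
    rwa [e]

lemma measurable_CtilStar (k : ℕ) : Measurable[st.pastSketch k τ] (st.CtilStar k) := by
  refine measurable_ofFn_reverse_prod _ fun j => ?_
  have hS : Measurable[st.pastSketch k τ] (st.S k j) := by
    refine Measurable.mono (comap_measurable (st.S k j)) ?_ le_rfl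
    refine le_trans ?_ le_sup_right
    exact le_iSup₂_of_le (j : ℕ) (Finset.mem_range.2 j.2) le_rfl
  have h := Measurable.skProj st.hpinvq st.Bstar hS
  exact measurable_matrix_iff.2 fun a b => (h.matrix_entry a b).const_sub _

lemma memLp_gradf_ξ (k : ℕ) : MemLp (fun ω => st.gradf st.xstar (st.ξ k ω)) 2 μ :=
  st.memLp_gradf.comp_measurePreserving (st.measurePreserving_ξ k)

lemma condExp_gradf_ξ (k : ℕ) (i : Fin d) :
    μ[fun ω => st.gradf st.xstar (st.ξ k ω) i | st.pastSketch k τ] =ᵐ[μ] 0 := by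
  have := st.hμ
  have hg := st.aemeasurable_gradf_apply i
  set g := hg.mk
  have hmp := st.measurePreserving_ξ k
  have hae : (fun ω => st.gradf st.xstar (st.ξ k ω) i) =ᵐ[μ] fun ω => g (st.ξ k ω) :=
    hmp.quasiMeasurePreserving.ae_eq_comp hg.ae_eq_mk
  refine (condExp_congr_ae hae).trans ?_
  have hi := condExp_indep_eq (st.hmeasξ k).comap_le (st.pastSketch_le k τ)
    (f := fun ω => g (st.ξ k ω))
    (hg.measurable_mk.comp (comap_measurable (st.ξ k))).stronglyMeasurable
    (st.indep_ξ_pastSketch k τ)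
  refine hi.trans (ae_of_all _ fun ω => ?_)
  change ∫ ω, g (st.ξ k ω) ∂μ = 0
  rw [← integral_map (hmp.measurable.aemeasurable) (by
    exact hg.measurable_mk.aestronglyMeasurable), hmp.map_eq,
    ← integral_congr_ae hg.ae_eq_mk, ← st.hgradFP, st.gradF_xstar]
  rfl

section
open scoped Matrix.Norms.L2Operator

lemma abs_entry_le_norm (A : Mat d) (i j : Fin d) : |A i j| ≤ ‖A‖ := by
  have h1 : mv A (EuclideanSpace.single j 1) i = A i j := by simp [mv_apply]
  rw [← h1, ← Real.norm_eq_abs]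
  refine (PiLp.norm_apply_le _ i).trans ((norm_mv_le A _).trans ?_)
  simp

lemma θtil_apply (k : ℕ) (ω : Ω) (i : Fin d) : st.θtil k ω i =
    -∑ j, ((1 - st.CtilStar k ω) * st.Bstar⁻¹) i j * st.gradf st.xstar (st.ξ k ω) j := by
  rw [← mv_apply]
  rfl

lemma measurable_sketchFactor (k : ℕ) (i j : Fin d) : Measurable[st.pastSketch k τ]
    fun ω => ((1 - st.CtilStar k ω) * st.Bstar⁻¹) i j := by
  have hC := st.measurable_CtilStar k
  have h1 : Measurable[st.pastSketch k τ] fun ω => 1 - st.CtilStar k ω :=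
    measurable_matrix_iff.2 fun a b => (hC.matrix_entry a b).const_sub _
  exact (h1.matrix_mul measurable_const).matrix_entry i j

lemma abs_sketchFactor_le (k : ℕ) (ω : Ω) (i j : Fin d) :
    |((1 - st.CtilStar k ω) * st.Bstar⁻¹) i j| ≤ 2 * ‖st.Bstar⁻¹‖ :=
  (abs_entry_le_norm _ i j).trans ((norm_mul_le _ _).trans
    (mul_le_mul_of_nonneg_right (st.norm_one_sub_CtilStar_le k ω) (norm_nonneg _)))

lemma memLp_gradf_ξ_apply (k : ℕ) (j : Fin d) :
    MemLp (fun ω => st.gradf st.xstar (st.ξ k ω) j) 2 μ := by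
  refine (st.memLp_gradf_ξ k).mono ?_ (ae_of_all _ fun ω => PiLp.norm_apply_le _ j)
  exact ((st.aemeasurable_gradf_apply j).comp_quasiMeasurePreserving
    (st.measurePreserving_ξ k).quasiMeasurePreserving).aestronglyMeasurable

lemma memLp_sketchFactor_mul (k : ℕ) (i j : Fin d) :
    MemLp (fun ω => ((1 - st.CtilStar k ω) * st.Bstar⁻¹) i j *
      st.gradf st.xstar (st.ξ k ω) j) 2 μ := by
  refine ((st.memLp_gradf_ξ_apply k j).const_mul (2 * ‖st.Bstar⁻¹‖)).mono
    (AEStronglyMeasurable.mul ?_ (st.memLp_gradf_ξ_apply k j).1) (ae_of_all _ fun ω => ?_)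
  · exact ((st.measurable_sketchFactor k i j).mono (st.pastSketch_le k τ)
      le_rfl).aestronglyMeasurable
  · rw [norm_mul, norm_mul, Real.norm_of_nonneg (by positivity : 0 ≤ 2 * ‖st.Bstar⁻¹‖)]
    exact mul_le_mul_of_nonneg_right (st.abs_sketchFactor_le k ω i j) (norm_nonneg _)

lemma memLp_θtil_apply (k : ℕ) (i : Fin d) : MemLp (fun ω => st.θtil k ω i) 2 μ := by
  simp only [θtil_apply]
  exact (memLp_finsetSum _ fun j _ => st.memLp_sketchFactor_mul k i j).neg

/-- `θ̃^k` has zero conditional mean given the past. -/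
lemma condExp_θtil (k : ℕ) (i : Fin d) : μ[fun ω => st.θtil k ω i | st.𝔉 k] =ᵐ[μ] 0 := by
  have := st.hμ
  have hle := st.pastSketch_le k τ
  set M : Fin d → Ω → ℝ := fun j ω => ((1 - st.CtilStar k ω) * st.Bstar⁻¹) i j
  set g : Fin d → Ω → ℝ := fun j ω => st.gradf st.xstar (st.ξ k ω) j
  have hint : ∀ j, Integrable (M j * g j) μ := fun j =>
    (st.memLp_sketchFactor_mul k i j).integrable one_le_two
  have hterm : ∀ j, μ[M j * g j | st.pastSketch k τ] =ᵐ[μ] 0 := fun j => by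
    have h1 := condExp_mul_of_stronglyMeasurable_left
      (st.measurable_sketchFactor k i j).stronglyMeasurable (hint j)
      ((st.memLp_gradf_ξ_apply k j).integrable one_le_two)
    filter_upwards [h1, st.condExp_gradf_ξ k j] with ω h1 h2
    rw [h1, Pi.mul_apply, h2]
    simp
  have e : (fun ω => st.θtil k ω i) = -∑ j, M j * g j := by
    funext ω
    simp [θtil_apply, M, g]
  have hsum : μ[fun ω => st.θtil k ω i | st.pastSketch k τ] =ᵐ[μ] 0 := by
    rw [e]
    refine (condExp_neg _ _).trans ?_
    have h2 := condExp_finsetSum (s := Finset.univ) (fun j _ => hint j) (st.pastSketch k τ)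
    have h3 : ∀ᵐ ω ∂μ, ∀ j, (μ[M j * g j | st.pastSketch k τ]) ω = 0 := ae_all_iff.2 hterm
    filter_upwards [h2, h3] with ω h2 h3
    rw [Pi.neg_apply, h2, Finset.sum_apply]
    simp [h3]
  refine (condExp_condExp_of_le (f := fun ω => st.θtil k ω i)
    (le_sup_left : st.𝔉 k ≤ st.pastSketch k τ) hle).symm.trans ?_
  exact (condExp_congr_ae hsum).trans (by rw [condExp_zero])

end

lemma measurable_Δbar (k : ℕ) : Measurable (st.Δbar k) := by
  have hx : ∀ t, Measurable (st.x t) := fun t => (st.hxadapt t).mono (st.h𝔉le t) le_rfl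
  have hα : Measurable (st.αbar k) := (st.hαnext k).mono (st.h𝔉le _) le_rfl
  have e : st.Δbar k = fun ω => (st.αbar k ω)⁻¹ • (st.x (k + 1) ω - st.x k ω) := by
    funext ω
    have hpos : 0 < st.αbar k ω := lt_of_lt_of_le
      (div_pos st.hcβ (Real.rpow_pos_of_pos (by positivity) _)) (st.hα k ω).1
    rw [st.hxrec, add_sub_cancel_left, inv_smul_smul₀ hpos.ne']
    rfl
  rw [e]
  exact hα.inv.smul ((hx _).sub (hx _))

end SNSetting

lemma lintegral_ofReal_sq_eq_eLpNorm {α : Type*} {mα : MeasurableSpace α} (ν : Measure α)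
    (f : α → ℝ) : ∫⁻ a, ENNReal.ofReal (f a ^ 2) ∂ν = eLpNorm f 2 ν ^ 2 := by
  have h := eLpNorm_nnreal_pow_eq_lintegral (f := f) (μ := ν) (p := 2) two_ne_zero
  have h2 : ((2 : NNReal) : ℝ) = ((2 : ℕ) : ℝ) := by simp
  rw [h2, ENNReal.rpow_natCast] at h
  refine Eq.trans (lintegral_congr fun a => ?_) h.symm
  rw [ENNReal.rpow_natCast, ← ofReal_norm, ← ENNReal.ofReal_pow (norm_nonneg _),
    Real.norm_eq_abs, sq_abs]

lemma lintegral_ofReal_norm_sq {α : Type*} {mα : MeasurableSpace α} (ν : Measure α) {d : ℕ}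
    {v : α → EV d} (hv : ∀ i, AEMeasurable (fun a => v a i) ν) :
    ∫⁻ a, ENNReal.ofReal (‖v a‖ ^ 2) ∂ν = ∑ i, eLpNorm (fun a => v a i) 2 ν ^ 2 := by
  simp only [← lintegral_ofReal_sq_eq_eLpNorm]
  rw [← lintegral_finsetSum' _ fun i _ => ((hv i).pow_const 2).ennreal_ofReal]
  refine lintegral_congr fun a => ?_
  rw [EuclideanSpace.real_norm_sq_eq, ENNReal.ofReal_sum_of_nonneg fun i _ => sq_nonneg _]

/-- Centering by the conditional mean at most doubles the `L²` norm. -/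
lemma eLpNorm_sub_condExp_le {Ω : Type*} {m mΩ : MeasurableSpace Ω} {μ : Measure Ω} {f : Ω → ℝ}
    (hf : AEStronglyMeasurable f μ) :
    eLpNorm (fun ω => f ω - (μ[f|m]) ω) 2 μ ≤ 2 * eLpNorm f 2 μ := by
  by_cases hm : m ≤ mΩ
  · refine (eLpNorm_sub_le hf (stronglyMeasurable_condExp.mono hm).aestronglyMeasurable
      one_le_two).trans ?_
    rw [two_mul]
    gcongr
    exact eLpNorm_condExp_le_eLpNorm f one_le_two
  · simp only [condExp_of_not_le hm, Pi.zero_apply, sub_zero, two_mul]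
    exact le_self_add

namespace SNSetting

variable {d q τ : ℕ} {Ω : Type*} [mΩ : MeasurableSpace Ω] {μ : Measure Ω}
  {Ξs : Type*} [MeasurableSpace Ξs] (st : SNSetting d q τ Ω μ Ξs)

lemma measurable_Δbar_apply (k : ℕ) (i : Fin d) : Measurable fun ω => st.Δbar k ω i :=
  (measurable_pi_apply i).comp ((MeasurableEquiv.toLp 2 (Fin d → ℝ)).symm.measurable.comp
    (st.measurable_Δbar k))

/-- `θ̂^k` is the centering of `Δ̄x_k - θ̃^k`, so its second moment is controlled by that of the
difference. -/
lemma lintegral_θhat_le (k : ℕ) : ∫⁻ ω, ENNReal.ofReal (‖st.θhat k ω‖ ^ 2) ∂μ ≤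
    4 * ∫⁻ ω, ENNReal.ofReal (‖st.Δbar k ω - st.θtil k ω‖ ^ 2) ∂μ := by
  have := st.hμ
  set D : Fin d → Ω → ℝ := fun i ω => st.Δbar k ω i - st.θtil k ω i with hD
  have hDm : ∀ i, AEMeasurable (D i) μ := fun i =>
    (st.measurable_Δbar_apply k i).aemeasurable.sub (st.memLp_θtil_apply k i).1.aemeasurable
  have hDsq : ∫⁻ ω, ENNReal.ofReal (‖st.Δbar k ω - st.θtil k ω‖ ^ 2) ∂μ =
      ∑ i, eLpNorm (D i) 2 μ ^ 2 := lintegral_ofReal_norm_sq μ hDm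
  rw [hDsq]
  by_cases htop : ∑ i, eLpNorm (D i) 2 μ ^ 2 = ⊤
  · rw [htop, ENNReal.mul_top (by norm_num)]
    exact le_top
  have hDL : ∀ i, MemLp (D i) 2 μ := fun i => by
    refine ⟨(hDm i).aestronglyMeasurable, lt_top_iff_ne_top.2 fun h => htop ?_⟩
    exact ENNReal.sum_eq_top.2 ⟨i, Finset.mem_univ i, by simp [h]⟩
  have hθ : ∀ i, (fun ω => st.θhat k ω i) =ᵐ[μ] fun ω => D i ω - (μ[D i | st.𝔉 k]) ω :=
    fun i => by
      have e : (fun ω => st.Δbar k ω i) = D i + fun ω => st.θtil k ω i := by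
        funext ω
        simp [hD]
      have h1 := condExp_add ((hDL i).integrable one_le_two)
        ((st.memLp_θtil_apply k i).integrable one_le_two) (st.𝔉 k)
      rw [← e] at h1
      filter_upwards [h1, st.condExp_θtil k i] with ω h1 h2
      have h3 : st.θhat k ω i =
          st.Δbar k ω i - (μ[fun ω' => st.Δbar k ω' i | st.𝔉 k]) ω - st.θtil k ω i := rfl
      rw [h3, h1, Pi.add_apply, h2, hD, Pi.zero_apply]
      ring
  have hθm : ∀ i, AEMeasurable (fun ω => st.θhat k ω i) μ := fun i =>
    ((hDm i).sub (stronglyMeasurable_condExp.mono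
      (st.h𝔉le k)).measurable.aemeasurable).congr (hθ i).symm
  rw [lintegral_ofReal_norm_sq μ hθm, Finset.mul_sum]
  refine Finset.sum_le_sum fun i _ => ?_
  rw [eLpNorm_congr_ae (hθ i)]
  calc eLpNorm (fun ω => D i ω - (μ[D i | st.𝔉 k]) ω) 2 μ ^ 2
      ≤ (2 * eLpNorm (D i) 2 μ) ^ 2 :=
        pow_le_pow_left' (eLpNorm_sub_condExp_le (hDL i).1) 2
    _ = 4 * eLpNorm (D i) 2 μ ^ 2 := by rw [mul_pow]; norm_num

lemma lintegral_norm_gradf_sq_ne_top :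
    ∫⁻ ξv, ENNReal.ofReal (‖st.gradf st.xstar ξv‖ ^ 2) ∂st.P ≠ ⊤ := by
  rw [lintegral_ofReal_sq_eq_eLpNorm]
  exact ENNReal.pow_ne_top st.memLp_gradf.norm.2.ne

lemma measurable_specNorm_B (k : ℕ) :
    Measurable[st.𝔉 k] fun ω => specNorm (st.B k ω - st.Bstar) := by
  have h : Measurable[st.𝔉 k] fun ω => st.B k ω - st.Bstar :=
    measurable_matrix_iff.2 fun i j => ((st.hBadapt k).matrix_entry i j).sub_const _
  have := borelSpace_matrix (m := d) (n := d)
  have hc : Continuous fun A : Mat d => specNorm A := by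
    unfold specNorm
    refine continuous_norm.comp ?_
    exact LinearMap.continuous_of_finiteDimensional
      (LinearMap.toContinuousLinearMap.toLinearMap ∘ₗ (Matrix.toEuclideanLin :
        Mat d ≃ₗ[ℝ] (EV d →ₗ[ℝ] EV d)).toLinearMap)
  exact hc.measurable.comp h

/-- The noise at the minimizer is independent of the averaged Hessian. -/
lemma lintegral_gradf_mul_specNorm (k : ℕ) :
    ∫⁻ ω, ENNReal.ofReal (‖st.gradf st.xstar (st.ξ k ω)‖ ^ 2) *
        ENNReal.ofReal (specNorm (st.B k ω - st.Bstar) ^ 2) ∂μ =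
      (∫⁻ ξv, ENNReal.ofReal (‖st.gradf st.xstar ξv‖ ^ 2) ∂st.P) *
        ∫⁻ ω, ENNReal.ofReal (specNorm (st.B k ω - st.Bstar) ^ 2) ∂μ := by
  have hg : AEMeasurable (fun ξv => ENNReal.ofReal (‖st.gradf st.xstar ξv‖ ^ 2)) st.P :=
    (st.aemeasurable_gradf.norm.pow_const 2).ennreal_ofReal
  have hmp := st.measurePreserving_ξ k
  have hae := hmp.quasiMeasurePreserving.ae_eq_comp hg.ae_eq_mk
  have hmk : ∫⁻ ω, hg.mk _ (st.ξ k ω) ∂μ = ∫⁻ ξv, hg.mk _ ξv ∂st.P :=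
    hmp.lintegral_comp hg.measurable_mk
  rw [lintegral_congr_ae hg.ae_eq_mk, ← hmk,
    ← lintegral_mul_eq_lintegral_mul_lintegral_of_independent_measurableSpace
      (st.hmeasξ k).comap_le (st.h𝔉le k) (st.hindepξ k)
      (f := fun ω => hg.mk _ (st.ξ k ω))
      (hg.measurable_mk.comp (comap_measurable (st.ξ k)))
      ((st.measurable_specNorm_B k).pow_const 2).ennreal_ofReal]
  refine lintegral_congr_ae ?_
  filter_upwards [hae] with ω h
  exact congrArg (· * _) h

lemma θhat_eq_zero (st : SNSetting d q 0 Ω μ Ξs) (k : ℕ) (ω : Ω) : st.θhat k ω = 0 := by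
  have h1 : ∀ ω, st.Δbar k ω = 0 := fun ω => st.hΔ0 k ω
  have h2 : st.θtil k ω = 0 := by
    simp [θtil, CtilStar, mv]
  have h3 : st.θv k ω = 0 := by
    have h0 : (fun _ : Ω => (0 : ℝ)) = 0 := rfl
    ext i
    simp [θv, h1, h0, condExp_zero]
  rw [θhat, h2, h3, sub_zero]

/-- Quantitative form of the moment bound, with a constant depending only on the setting. -/
lemma exists_lintegral_θhat_le : ∃ C : ℝ, 0 ≤ C ∧ ∀ k,
    ∫⁻ ω, ENNReal.ofReal (‖st.θhat k ω‖ ^ 2) ∂μ ≤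
      ENNReal.ofReal C * (∫⁻ ω, ENNReal.ofReal (‖st.x k ω - st.xstar‖ ^ 2) ∂μ +
        ∫⁻ ω, ENNReal.ofReal (specNorm (st.B k ω - st.Bstar) ^ 2) ∂μ) := by
  obtain ⟨K, hK, hD⟩ := st.exists_norm_Δbar_sub_θtil_le
  set M := ∫⁻ ξv, ENNReal.ofReal (‖st.gradf st.xstar ξv‖ ^ 2) ∂st.P with hM
  have hMr : M = ENNReal.ofReal M.toReal :=
    (ENNReal.ofReal_toReal st.lintegral_norm_gradf_sq_ne_top).symm
  have hM0 : 0 ≤ M.toReal := ENNReal.toReal_nonneg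
  refine ⟨4 * (2 * K ^ 2) * (1 + M.toReal), by positivity, fun k => ?_⟩
  set X := ∫⁻ ω, ENNReal.ofReal (‖st.x k ω - st.xstar‖ ^ 2) ∂μ
  set Y := ∫⁻ ω, ENNReal.ofReal (specNorm (st.B k ω - st.Bstar) ^ 2) ∂μ
  have hx : Measurable fun ω => ‖st.x k ω - st.xstar‖ :=
    (((st.hxadapt k).mono (st.h𝔉le k) le_rfl).sub_const _).norm
  have hDle : ∫⁻ ω, ENNReal.ofReal (‖st.Δbar k ω - st.θtil k ω‖ ^ 2) ∂μ ≤
      ENNReal.ofReal (2 * K ^ 2) * (X + M * Y) := by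
    rw [hM, ← st.lintegral_gradf_mul_specNorm k,
      ← lintegral_add_left (hx.pow_const 2).ennreal_ofReal,
      ← lintegral_const_mul' _ _ ENNReal.ofReal_ne_top]
    refine lintegral_mono fun ω => ?_
    rw [← ENNReal.ofReal_mul (by positivity), ← ENNReal.ofReal_add (by positivity)
      (by positivity), ← ENNReal.ofReal_mul (by positivity)]
    refine ENNReal.ofReal_le_ofReal
      ((pow_le_pow_left₀ (norm_nonneg _) (hD k ω) 2).trans ?_)
    rw [mul_pow, ← mul_pow ‖st.gradf st.xstar (st.ξ k ω)‖, mul_assoc, mul_left_comm 2]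
    exact mul_le_mul_of_nonneg_left (add_sq_le) (sq_nonneg K)
  have h4 : (4 : ℝ≥0∞) = ENNReal.ofReal 4 := by simp
  calc ∫⁻ ω, ENNReal.ofReal (‖st.θhat k ω‖ ^ 2) ∂μ
      ≤ 4 * (ENNReal.ofReal (2 * K ^ 2) * (X + M * Y)) :=
        (st.lintegral_θhat_le k).trans (by gcongr)
    _ ≤ 4 * (ENNReal.ofReal (2 * K ^ 2) * ((1 + M) * (X + Y))) := by
        gcongr
        rw [add_mul, one_mul, mul_add]
        gcongr
        · exact le_self_add
        · exact le_add_self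
    _ = _ := by
        rw [ENNReal.ofReal_mul (p := 4 * (2 * K ^ 2)) (by positivity),
          ENNReal.ofReal_mul (p := 4) (by positivity), ← h4,
          ENNReal.ofReal_add zero_le_one hM0, ENNReal.ofReal_one, ← hMr]
        ring

end SNSetting

/-- **Second-moment bound on the martingale approximation error** (Lemma A.10 of the paper).
Under Assumptions (A1)–(A4), if `τ ≥ log(γ_H/(4Υ_H))/log ρ` with `ρ = 1 − γ_S` and
`β ∈ (0, 1)`, `χ > β`, `c_β, c_χ > 0`, then there is a constant `c > 0` independent of `k`
such that for all `k`,
`E[‖θ̂^k‖²] ≤ c ((Υ_H²/γ_H²) E[‖x_k − x*‖²] + (τ² Υ_S √C_{g,2}/γ_H⁴) E[‖B_k − B*‖²])`,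
where `θ̂^k = θ^k − θ̃^k`. -/
theorem theta_hat_second_moment_bound
    {d q τ : ℕ} {Ω : Type*} [MeasurableSpace Ω] {μ : MeasureTheory.Measure Ω}
    {Ξs : Type*} [MeasurableSpace Ξs] (st : SNSetting d q τ Ω μ Ξs)
    (hτ : Real.log (st.γH / (4 * st.ΥH)) / Real.log (1 - st.γS) ≤ (τ : ℝ))
    (hβ : 0 < st.β ∧ st.β < 1)
    (hχ : st.β < st.χ) :
    ∃ c : ℝ, 0 < c ∧ ∀ k : ℕ,
      ∫⁻ ω, ENNReal.ofReal (‖st.θhat k ω‖ ^ 2) ∂μ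
        ≤ ENNReal.ofReal c *
          (ENNReal.ofReal (st.ΥH ^ 2 / st.γH ^ 2) *
              ∫⁻ ω, ENNReal.ofReal (‖st.x k ω - st.xstar‖ ^ 2) ∂μ +
            ENNReal.ofReal ((τ : ℝ) ^ 2 * st.ΥS * Real.sqrt st.Cg2 / st.γH ^ 4) *
              ∫⁻ ω, ENNReal.ofReal (specNorm (st.B k ω - st.Bstar) ^ 2) ∂μ) := by
  rcases Nat.eq_zero_or_pos τ with rfl | hτ0
  · exact ⟨1, one_pos, fun k => by simp [st.θhat_eq_zero]⟩
  obtain ⟨C, hC, hle⟩ := st.exists_lintegral_θhat_le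
  have hΥH : 0 < st.ΥH := st.hγH.trans_le st.hγΥ
  have hτ1 : (0 : ℝ) < τ := Nat.cast_pos.2 hτ0
  have ha : 0 < st.ΥH ^ 2 / st.γH ^ 2 := div_pos (pow_pos hΥH 2) (pow_pos st.hγH 2)
  have hb : 0 < (τ : ℝ) ^ 2 * st.ΥS * Real.sqrt st.Cg2 / st.γH ^ 4 :=
    div_pos (mul_pos (mul_pos (pow_pos hτ1 2) st.hΥS) (Real.sqrt_pos.2 st.hCg2))
      (pow_pos st.hγH 4)
  set a := st.ΥH ^ 2 / st.γH ^ 2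
  set b := (τ : ℝ) ^ 2 * st.ΥS * Real.sqrt st.Cg2 / st.γH ^ 4
  refine ⟨C / a + C / b + 1, by positivity, fun k => (hle k).trans ?_⟩
  have h1 : C ≤ (C / a + C / b + 1) * a := by
    have : C / a * a = C := div_mul_cancel₀ _ ha.ne'
    have h2 : 0 ≤ (C / b + 1) * a := by positivity
    linarith
  have h2 : C ≤ (C / a + C / b + 1) * b := by
    have : C / b * b = C := div_mul_cancel₀ _ hb.ne'
    have h2 : 0 ≤ (C / a + 1) * b := by positivity
    linarith
  rw [mul_add, mul_add, ← mul_assoc, ← mul_assoc, ← ENNReal.ofReal_mul (by positivity),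
    ← ENNReal.ofReal_mul (by positivity)]
  gcongr
end
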